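/- Let 0 < α < 1 be an algebraic irrational real number, let K = ℚ(α) be the number field generated by α, with ring of integers O_K, and let 𝔞 = {r ∈ O_K : r·α ∈ O_K}, the denominator ideal of α, so that for every integer n ≥ 0 the set I_n = (n+α)·𝔞 = {(n+α)·x : x ∈ 𝔞} is an integral ideal of O_K. Let q be a positive integer and fix b ∈ {0, …, q-1}. Then there exists an integer N₀ > 10^6·q (depending on α and q) such that for every integer N > N₀, with M = ⌊10^{-6}·N⌋, the number of integers n with N < n ≤ N+M and n ≡ b (mod q) for which there exists a prime ideal 𝔭 of O_K dividing I_n but not dividing ∏_{m ≤ N+M, m ≠ n} I_m, is at least 0.54·M/q. -/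

import Mathlib

open NumberField Nat in
theorem card_primes_containing_le {K : Type*} [Field K] [NumberField K] {p : ℕ} (hp : p.Prime)
    (s : Finset (Ideal (𝓞 K))) (hs : ∀ P ∈ s, P.IsPrime ∧ (p : 𝓞 K) ∈ P) :
    s.card ≤ Module.finrank ℤ (𝓞 K) := by
  have hp0 : Ideal.span {(p : 𝓞 K)} ≠ ⊥ := by
    simpa [Ideal.span_singleton_eq_bot] using hp.ne_zero
  have hne : ∀ P ∈ s, P ≠ ⊥ := by
    rintro P hP rfl
    exact hp.ne_zero (by simpa using (hs _ hP).2)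
  have hdvd : ∏ P ∈ s, P ∣ Ideal.span {(p : 𝓞 K)} := by
    refine Finset.prod_primes_dvd _ (fun P hP => ?_) (fun P hP => ?_)
    · exact (Ideal.prime_iff_isPrime (hne P hP)).2 (hs P hP).1
    · rw [Ideal.dvd_span_singleton]
      exact (hs P hP).2
  have h1 : ∏ P ∈ s, Ideal.absNorm P ∣ p ^ Module.finrank ℤ (𝓞 K) := by
    rw [← Ideal.absNorm_span_natCast, ← map_prod]
    exact map_dvd _ hdvd
  have h2 : ∀ P ∈ s, p ≤ Ideal.absNorm P := by
    intro P hP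
    have hd : Ideal.absNorm P ∣ p ^ Module.finrank ℤ (𝓞 K) := by
      rw [← Ideal.absNorm_span_natCast]
      exact map_dvd _ (Ideal.dvd_span_singleton.2 (hs P hP).2)
    obtain ⟨k, -, hk⟩ := (Nat.dvd_prime_pow hp).1 hd
    have : k ≠ 0 := by
      rintro rfl
      rw [pow_zero, Ideal.absNorm_eq_one_iff] at hk
      exact (hs P hP).1.ne_top hk
    rw [hk]
    exact Nat.le_self_pow this p
  have h3 : p ^ s.card ≤ p ^ Module.finrank ℤ (𝓞 K) := by
    refine le_trans ?_ (Nat.le_of_dvd (pow_pos hp.pos _) h1)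
    rw [← Finset.prod_const]
    exact Finset.prod_le_prod' h2
  exact (Nat.pow_le_pow_iff_right hp.one_lt).1 h3

/-- The nonzero ideals of norm at most `n`. -/
noncomputable def idealsLE (K : Type*) [Field K] [NumberField K] (n : ℕ) :
    Finset (Ideal (NumberField.RingOfIntegers K)) :=
  by classical exact (Ideal.finite_setOfPred_absNorm_le n).toFinset.filter (· ≠ ⊥)

/-- The nonzero prime ideals of norm at most `n`. -/
noncomputable def primeIdealsLE (K : Type*) [Field K] [NumberField K] (n : ℕ) :
    Finset (Ideal (NumberField.RingOfIntegers K)) :=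
  by classical exact (idealsLE K n).filter (·.IsPrime)

section
variable {K : Type*} [Field K] [NumberField K]
open NumberField

theorem mem_idealsLE {n : ℕ} {I : Ideal (𝓞 K)} :
    I ∈ idealsLE K n ↔ Ideal.absNorm I ≤ n ∧ I ≠ ⊥ := by
  simp [idealsLE]

theorem mem_primeIdealsLE {n : ℕ} {I : Ideal (𝓞 K)} :
    I ∈ primeIdealsLE K n ↔ Ideal.absNorm I ≤ n ∧ I ≠ ⊥ ∧ I.IsPrime := by
  simp [primeIdealsLE, mem_idealsLE, and_assoc]

theorem two_le_absNorm {I : Ideal (𝓞 K)} (h0 : I ≠ ⊥) (h1 : I.IsPrime) :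
    2 ≤ Ideal.absNorm I := by
  have := mt Ideal.absNorm_eq_zero_iff.1 h0
  have := mt Ideal.absNorm_eq_one_iff.1 h1.ne_top
  omega

theorem card_idealsLE_filter_dvd {n : ℕ} {J : Ideal (𝓞 K)} (hJ : J ≠ ⊥) [DecidablePred (J ∣ ·)] :
    ((idealsLE K n).filter (J ∣ ·)).card = (idealsLE K (n / Ideal.absNorm J)).card := by
  symm
  have hJ0 : 0 < Ideal.absNorm J := Nat.pos_of_ne_zero (mt Ideal.absNorm_eq_zero_iff.1 hJ)
  refine Finset.card_bij (fun I _ => J * I) ?_ ?_ ?_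
  · intro I hI
    rw [mem_idealsLE, Nat.le_div_iff_mul_le hJ0] at hI
    rw [Finset.mem_filter, mem_idealsLE, map_mul, mul_comm]
    exact ⟨⟨hI.1, mul_ne_zero hJ hI.2⟩, dvd_mul_right _ _⟩
  · intro I _ I' _ h
    exact mul_left_cancel₀ hJ h
  · intro I hI
    rw [Finset.mem_filter, mem_idealsLE] at hI
    obtain ⟨⟨h1, h2⟩, I', rfl⟩ := hI
    refine ⟨I', ?_, rfl⟩
    rw [map_mul, mul_comm] at h1
    rw [mem_idealsLE, Nat.le_div_iff_mul_le hJ0]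
    exact ⟨h1, fun h => h2 (by simp [h])⟩

open Classical in
theorem log_absNorm_eq {n : ℕ} {I : Ideal (𝓞 K)} (hI : I ∈ idealsLE K n) :
    Real.log (Ideal.absNorm I) = ∑ P ∈ primeIdealsLE K n, ∑ k ∈ Finset.Icc 1 n,
      if P ^ k ∣ I then Real.log (Ideal.absNorm P) else 0 := by
  rw [mem_idealsLE] at hI
  obtain ⟨hn, h0⟩ := hI
  have hprod : (UniqueFactorizationMonoid.normalizedFactors I).prod = I :=
    Ideal.prod_normalizedFactors_eq_self h0
  have hpos : 0 < Ideal.absNorm I := Nat.pos_of_ne_zero (mt Ideal.absNorm_eq_zero_iff.1 h0)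
  have hprime : ∀ P ∈ UniqueFactorizationMonoid.normalizedFactors I, P ∈ primeIdealsLE K n := by
    intro P hP
    have h := UniqueFactorizationMonoid.prime_of_normalized_factor P hP
    have hd := UniqueFactorizationMonoid.dvd_of_mem_normalizedFactors hP
    rw [mem_primeIdealsLE]
    exact ⟨(Nat.le_of_dvd hpos (map_dvd _ hd)).trans hn, h.ne_zero, Ideal.isPrime_of_prime h⟩
  have h1 : (Ideal.absNorm I : ℝ) = ((UniqueFactorizationMonoid.normalizedFactors I).map
      (fun P => (Ideal.absNorm P : ℝ))).prod := by
    conv_lhs => rw [← hprod]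
    rw [map_multiset_prod, Nat.cast_multiset_prod, Multiset.map_map]
    rfl
  rw [h1, Finset.prod_multiset_map_count, Real.log_prod]
  · rw [← Finset.sum_subset (s₁ := (UniqueFactorizationMonoid.normalizedFactors I).toFinset)
      (s₂ := primeIdealsLE K n)]
    · refine Finset.sum_congr rfl fun P hP => ?_
      have hP' := hprime P (Multiset.mem_toFinset.1 hP)
      rw [mem_primeIdealsLE] at hP'
      rw [Real.log_pow, ← Finset.sum_filter, Finset.sum_const, nsmul_eq_mul]
      congr 2
      have hirr : Irreducible P := ((Ideal.prime_iff_isPrime hP'.2.1).2 hP'.2.2).irreducible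
      have hdvd : ∀ k, P ^ k ∣ I ↔
          k ≤ (UniqueFactorizationMonoid.normalizedFactors I).count P := by
        intro k
        rw [pow_dvd_iff_le_emultiplicity,
          UniqueFactorizationMonoid.emultiplicity_eq_count_normalizedFactors hirr h0, normalize_eq]
        norm_cast
      have : (Finset.Icc 1 n).filter (fun k => P ^ k ∣ I) =
          Finset.Icc 1 ((UniqueFactorizationMonoid.normalizedFactors I).count P) := by
        ext k
        simp only [Finset.mem_filter, Finset.mem_Icc, hdvd]
        constructor
        · rintro ⟨⟨h, -⟩, h'⟩; exact ⟨h, h'⟩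
        · rintro ⟨h, h'⟩
          refine ⟨⟨h, ?_⟩, h'⟩
          have := Nat.le_of_dvd hpos (map_dvd Ideal.absNorm ((hdvd k).2 h'))
          rw [map_pow] at this
          exact (Nat.lt_two_pow_self.le.trans (Nat.pow_le_pow_left
            (two_le_absNorm hP'.2.1 hP'.2.2) k)).trans (this.trans hn)
      rw [this, Nat.card_Icc, Nat.add_sub_cancel]
    · intro P hP
      exact hprime P (Multiset.mem_toFinset.1 hP)
    · intro P hP hP'
      refine Finset.sum_eq_zero fun k hk => if_neg fun hd => hP' ?_
      rw [mem_primeIdealsLE] at hP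
      rw [Multiset.mem_toFinset, Ideal.mem_normalizedFactors_iff h0]
      refine ⟨hP.2.2, ?_⟩
      rw [← Ideal.dvd_iff_le]
      exact (dvd_pow_self P (by have := (Finset.mem_Icc.1 hk).1; omega)).trans hd
  · intro P hP
    have hP' := hprime P (Multiset.mem_toFinset.1 hP)
    rw [mem_primeIdealsLE] at hP'
    have := two_le_absNorm hP'.2.1 hP'.2.2
    positivity

open Classical in
theorem sum_log_absNorm_eq (n : ℕ) :
    ∑ I ∈ idealsLE K n, Real.log (Ideal.absNorm I) = ∑ P ∈ primeIdealsLE K n,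
      Real.log (Ideal.absNorm P) *
        ∑ k ∈ Finset.Icc 1 n, ((idealsLE K (n / Ideal.absNorm P ^ k)).card : ℝ) := by
  rw [Finset.sum_congr rfl fun I hI => log_absNorm_eq hI, Finset.sum_comm]
  refine Finset.sum_congr rfl fun P hP => ?_
  rw [mem_primeIdealsLE] at hP
  rw [Finset.sum_comm, Finset.mul_sum]
  refine Finset.sum_congr rfl fun k _ => ?_
  rw [← map_pow, ← card_idealsLE_filter_dvd (pow_ne_zero k hP.2.1), ← Finset.sum_filter,
    Finset.sum_const, nsmul_eq_mul, mul_comm]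

end

section
variable (K : Type*) [Field K] [NumberField K]
open NumberField

theorem exists_card_idealsLE_asymp : ∃ κ : ℝ, 0 < κ ∧ ∀ ε : ℝ, 0 < ε → ∃ C : ℝ, 0 ≤ C ∧
    ∀ n : ℕ, |((idealsLE K n).card : ℝ) - κ * n| ≤ ε * n + C := by
  have hlim := (NumberField.Ideal.tendsto_norm_le_div_atTop₀ K).comp
    (tendsto_natCast_atTop_atTop (R := ℝ))
  set κ : ℝ := (2 ^ InfinitePlace.nrRealPlaces K * (2 * Real.pi) ^ InfinitePlace.nrComplexPlaces K *
    Units.regulator K * classNumber K) / (Units.torsionOrder K * Real.sqrt |discr K|) with hκ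
  have hκ0 : 0 < κ := by
    have h1 : 0 < classNumber K := Fintype.card_pos
    have h2 := Units.regulator_pos K
    have h3 : 0 < Units.torsionOrder K := Nat.pos_of_ne_zero (Units.torsionOrder_ne_zero K)
    have h4 : (0 : ℝ) < |(discr K : ℝ)| := abs_pos.2 (by exact_mod_cast discr_ne_zero K)
    have h5 := Real.pi_pos
    rw [hκ]
    positivity
  refine ⟨κ, hκ0, fun ε hε => ?_⟩
  have hcard : ∀ n : ℕ, Nat.card {I : nonZeroDivisors (Ideal (𝓞 K)) //
      (Ideal.absNorm (I : Ideal (𝓞 K)) : ℝ) ≤ (n : ℝ)} = (idealsLE K n).card := by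
    intro n
    rw [← Nat.card_eq_finsetCard]
    refine Nat.card_congr ⟨fun I => ⟨I.1.1, ?_⟩, fun I => ⟨⟨I.1, ?_⟩, ?_⟩, fun _ => rfl, fun _ => rfl⟩
    · rw [mem_idealsLE]
      exact ⟨by exact_mod_cast I.2, nonZeroDivisors.ne_zero I.1.2⟩
    · exact mem_nonZeroDivisors_of_ne_zero (mem_idealsLE.1 I.2).2
    · exact_mod_cast (mem_idealsLE.1 I.2).1
  obtain ⟨n₀, hn₀⟩ := (Metric.tendsto_atTop.1 hlim) ε hε
  refine ⟨(idealsLE K n₀).card + κ * n₀, by positivity, fun n => ?_⟩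
  rcases le_total n₀ n with h | h
  · have h' := hn₀ n h
    rw [Function.comp_apply, Real.dist_eq, hcard] at h'
    rcases Nat.eq_zero_or_pos n with rfl | hn
    · have : (idealsLE K 0).card ≤ (idealsLE K n₀).card := Finset.card_le_card fun I hI => by
        rw [mem_idealsLE] at hI ⊢; exact ⟨hI.1.trans (Nat.zero_le _), hI.2⟩
      have h2 : ((idealsLE K 0).card : ℝ) ≤ (idealsLE K n₀).card := by exact_mod_cast this
      simp only [Nat.cast_zero, mul_zero, sub_zero, zero_add, Nat.abs_cast]
      have : 0 ≤ κ * n₀ := by positivity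
      linarith
    · have hn' : (0 : ℝ) < n := by exact_mod_cast hn
      have h3 : ((idealsLE K n).card : ℝ) - κ * n = ((idealsLE K n).card / n - κ) * n := by
        field_simp
      rw [h3, abs_mul, abs_of_pos hn']
      have := mul_le_mul_of_nonneg_right h'.le hn'.le
      have : 0 ≤ κ * n₀ := by positivity
      have : (0 : ℝ) ≤ (idealsLE K n₀).card := by positivity
      linarith
  · have : (idealsLE K n).card ≤ (idealsLE K n₀).card := Finset.card_le_card fun I hI => by
      rw [mem_idealsLE] at hI ⊢; exact ⟨hI.1.trans h, hI.2⟩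
    have h2 : ((idealsLE K n).card : ℝ) ≤ (idealsLE K n₀).card := by exact_mod_cast this
    have h3 : (n : ℝ) ≤ n₀ := by exact_mod_cast h
    have h4 : κ * n ≤ κ * n₀ := by gcongr
    have h5 : 0 ≤ κ * n := by positivity
    have h6 : (0 : ℝ) ≤ (idealsLE K n).card := by positivity
    have h7 : 0 ≤ ε * n := by positivity
    rw [abs_le]
    constructor <;> linarith

end

theorem exists_sum_primesLE_rpow_le : ∃ C : ℝ, 0 ≤ C ∧
    ∀ n : ℕ, ∑ p ∈ Nat.primesLE n, (p : ℝ) ^ (-(3 / 2) : ℝ) ≤ C := by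
  have hs : Summable fun p : ℕ => (p : ℝ) ^ (-(3 / 2) : ℝ) :=
    Real.summable_nat_rpow.2 (by norm_num)
  exact ⟨_, tsum_nonneg fun p => by positivity,
    fun n => hs.sum_le_tsum _ fun p _ => by positivity⟩

section
variable {K : Type*} [Field K] [NumberField K]
open NumberField

theorem exists_prime_of_mem_primeIdealsLE {n : ℕ} {P : Ideal (𝓞 K)} (hP : P ∈ primeIdealsLE K n) :
    ∃ p k : ℕ, 0 < k ∧ (p : 𝓞 K) ∈ P ∧ p.Prime ∧ Ideal.absNorm P = p ^ k := by
  rw [mem_primeIdealsLE] at hP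
  have : P.IsMaximal := hP.2.2.isMaximal hP.2.1
  exact Ideal.exists_prime_and_absNorm_eq_pow P

theorem sum_primeIdeals_le {n : ℕ} (s : Finset (Ideal (𝓞 K))) (hs : s ⊆ primeIdealsLE K n)
    (f : Ideal (𝓞 K) → ℝ) (g : ℕ → ℝ) (hg : ∀ p, 0 ≤ g p)
    (hfg : ∀ P ∈ s, ∀ p k : ℕ, p.Prime → Ideal.absNorm P = p ^ k → 0 < k → f P ≤ g p) :
    ∑ P ∈ s, f P ≤ Module.finrank ℤ (𝓞 K) * ∑ p ∈ Nat.primesLE n, g p := by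
  classical
  have hmap : ∀ P ∈ s, (Ideal.absNorm P).minFac ∈ Nat.primesLE n := by
    intro P hP
    have h := hs hP
    rw [mem_primeIdealsLE] at h
    have h2 := two_le_absNorm h.2.1 h.2.2
    rw [Nat.mem_primesLE]
    exact ⟨(Nat.minFac_le (by omega)).trans h.1, Nat.minFac_prime (by omega)⟩
  rw [← Finset.sum_fiberwise_of_maps_to hmap, Finset.mul_sum]
  refine Finset.sum_le_sum fun p hp => ?_
  have hpp := Nat.prime_of_mem_primesLE hp
  have key : ∀ P ∈ s.filter (fun P => (Ideal.absNorm P).minFac = p),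
      P.IsPrime ∧ (p : 𝓞 K) ∈ P ∧ f P ≤ g p := by
    intro P hP
    rw [Finset.mem_filter] at hP
    obtain ⟨q, k, hk, hq, hqp, hN⟩ := exists_prime_of_mem_primeIdealsLE (hs hP.1)
    have : q = p := by
      rw [← hP.2, hN, Nat.Prime.pow_minFac hqp hk.ne']
    subst this
    exact ⟨(mem_primeIdealsLE.1 (hs hP.1)).2.2, hq, hfg P hP.1 q k hqp hN hk⟩
  calc ∑ P ∈ s.filter (fun P => (Ideal.absNorm P).minFac = p), f P
      ≤ ∑ P ∈ s.filter (fun P => (Ideal.absNorm P).minFac = p), g p :=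
        Finset.sum_le_sum fun P hP => (key P hP).2.2
    _ = (s.filter (fun P => (Ideal.absNorm P).minFac = p)).card * g p := by
        rw [Finset.sum_const, nsmul_eq_mul]
    _ ≤ _ := by
        refine mul_le_mul_of_nonneg_right ?_ (hg p)
        exact_mod_cast card_primes_containing_le hpp _ fun P hP => ⟨(key P hP).1, (key P hP).2.1⟩

end

theorem Real.log_div_le_rpow {x : ℝ} (hx : 1 ≤ x) : Real.log x / x ≤ 4 * x ^ (-(3 / 4) : ℝ) := by
  have h0 : 0 < x := by linarith
  have h1 := Real.log_le_rpow_div h0.le (show (0 : ℝ) < 1 / 4 by norm_num)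
  rw [div_le_iff₀ h0, mul_assoc, ← Real.rpow_add_one h0.ne']
  norm_num at h1 ⊢
  linarith

theorem Real.log_div_sq_le_rpow {x : ℝ} (hx : 1 ≤ x) :
    Real.log x / x ^ 2 ≤ 2 * x ^ (-(3 / 2) : ℝ) := by
  have h0 : 0 < x := by linarith
  have h1 := Real.log_le_rpow_div h0.le (show (0 : ℝ) < 1 / 2 by norm_num)
  rw [div_le_iff₀ (by positivity), mul_assoc, ← Real.rpow_natCast, ← Real.rpow_add h0]
  norm_num at h1 ⊢
  linarith

section
variable (K : Type*) [Field K] [NumberField K]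
open NumberField

theorem exists_sum_log_absNorm_div_sq_le : ∃ C : ℝ, 0 ≤ C ∧ ∀ n : ℕ,
    ∑ P ∈ primeIdealsLE K n, Real.log (Ideal.absNorm P) / (Ideal.absNorm P : ℝ) ^ 2 ≤ C := by
  obtain ⟨C, hC0, hC⟩ := exists_sum_primesLE_rpow_le
  refine ⟨Module.finrank ℤ (𝓞 K) * (2 * C), by positivity, fun n => ?_⟩
  refine (sum_primeIdeals_le _ subset_rfl _ (fun p => 2 * (p : ℝ) ^ (-(3 / 2) : ℝ))
    (fun p => by positivity) ?_).trans ?_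
  · intro P _ p k hp hN hk
    have h1 : (1 : ℝ) ≤ p := by exact_mod_cast hp.one_le
    have h2 : (p : ℝ) ≤ Ideal.absNorm P := by
      rw [hN]; exact_mod_cast Nat.le_self_pow hk.ne' p
    refine (Real.log_div_sq_le_rpow (h1.trans h2)).trans ?_
    gcongr 2 * ?_
    exact Real.rpow_le_rpow_of_nonpos (by linarith) h2 (by norm_num)
  · rw [← Finset.mul_sum]
    gcongr
    exact hC n

theorem exists_sum_log_absNorm_div_le : ∃ C : ℝ, 0 ≤ C ∧ ∀ n : ℕ,
    ∑ P ∈ primeIdealsLE K n with ¬ (Ideal.absNorm P).Prime,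
      Real.log (Ideal.absNorm P) / (Ideal.absNorm P : ℝ) ≤ C := by
  obtain ⟨C, hC0, hC⟩ := exists_sum_primesLE_rpow_le
  refine ⟨Module.finrank ℤ (𝓞 K) * (4 * C), by positivity, fun n => ?_⟩
  refine (sum_primeIdeals_le _ (Finset.filter_subset _ _) _
    (fun p => 4 * (p : ℝ) ^ (-(3 / 2) : ℝ)) (fun p => by positivity) ?_).trans ?_
  · intro P hP p k hp hN hk
    have h1 : (1 : ℝ) ≤ p := by exact_mod_cast hp.one_le
    have hk2 : 2 ≤ k := by
      by_contra hlt
      obtain rfl : k = 1 := by omega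
      exact (Finset.mem_filter.1 hP).2 (by rwa [hN, pow_one])
    have h2 : (p : ℝ) ^ 2 ≤ Ideal.absNorm P := by
      rw [hN]; exact_mod_cast Nat.pow_le_pow_right hp.pos hk2
    refine (Real.log_div_le_rpow ((one_le_pow₀ h1).trans h2)).trans ?_
    gcongr 4 * ?_
    refine (Real.rpow_le_rpow_of_nonpos (by positivity) h2 (by norm_num)).trans ?_
    rw [← Real.rpow_natCast, ← Real.rpow_mul (by positivity)]
    norm_num
  · rw [← Finset.mul_sum]
    gcongr
    exact hC n

theorem exists_sum_log_absNorm_le : ∃ C : ℝ, 0 ≤ C ∧ ∀ n : ℕ,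
    ∑ P ∈ primeIdealsLE K n, Real.log (Ideal.absNorm P) ≤ C * n := by
  obtain ⟨C, hC0, hC⟩ := exists_sum_log_absNorm_div_le K
  refine ⟨Module.finrank ℤ (𝓞 K) * Real.log 4 + C, by positivity, fun n => ?_⟩
  rw [← Finset.sum_filter_add_sum_filter_not _ (fun P => (Ideal.absNorm P).Prime), add_mul]
  refine add_le_add ?_ ?_
  · refine (sum_primeIdeals_le _ (Finset.filter_subset _ _) _ (fun p => Real.log p)
      (fun p => Real.log_natCast_nonneg p) ?_).trans ?_
    · intro P hP p k hp hN hk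
      have := (Finset.mem_filter.1 hP).2
      rw [hN] at this ⊢
      rw [(Nat.Prime.eq_one_of_pow this), pow_one]
    · rw [mul_assoc, ← Chebyshev.theta_eq_sum_primesLE_log]
      gcongr
      exact Chebyshev.theta_le_log4_mul_x (by positivity)
  · refine le_trans ?_ (mul_le_mul_of_nonneg_right (hC n) (by positivity))
    rw [Finset.sum_mul]
    refine Finset.sum_le_sum fun P hP => ?_
    have h := mem_primeIdealsLE.1 (Finset.mem_filter.1 hP).1
    have h2 := two_le_absNorm h.2.1 h.2.2
    have h3 : (Ideal.absNorm P : ℝ) ≤ n := by exact_mod_cast h.1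
    rw [div_mul_eq_mul_div, le_div_iff₀ (by positivity)]
    gcongr

end

theorem sum_pow_Icc_two_le {x : ℝ} (hx0 : 0 ≤ x) (hx : x ≤ 1 / 2) (n : ℕ) :
    ∑ k ∈ Finset.Icc 2 n, x ^ k ≤ 2 * x ^ 2 := by
  have hs : Summable fun k : ℕ => x ^ k := summable_geometric_of_lt_one hx0 (by linarith)
  have h1 : ∑ k ∈ Finset.Icc 2 n, x ^ k = x ^ 2 * ∑ k ∈ Finset.range (n - 1), x ^ k := by
    rw [Finset.mul_sum, ← Finset.Ico_succ_right_eq_Icc, Finset.sum_Ico_eq_sum_range]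
    refine Finset.sum_congr (by simp) fun k _ => by rw [pow_add]
  have h2 : ∑ k ∈ Finset.range (n - 1), x ^ k ≤ 2 := by
    refine (hs.sum_le_tsum _ fun k _ => by positivity).trans ?_
    rw [tsum_geometric_of_lt_one hx0 (by linarith), inv_le_comm₀ (by linarith) (by norm_num)]
    linarith
  rw [h1, mul_comm]
  gcongr

theorem abs_log_mul_sum_sub_le {F : ℕ → ℝ} {κ ε C₁ C₄ : ℝ} (hκ : 0 ≤ κ) (hε : 0 ≤ ε)
    (hC₄ : 0 ≤ C₄) (hF0 : ∀ m, 0 ≤ F m) (hF : ∀ m : ℕ, |F m - κ * m| ≤ ε * m + C₁)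
    (hF4 : ∀ m, F m ≤ C₄ * m) {n : ℕ} {q : ℕ} (hq2 : 2 ≤ q) (hqn : q ≤ n) :
    |Real.log q * ∑ k ∈ Finset.Icc 1 n, F (n / q ^ k) - κ * (n * (Real.log q / q))| ≤
      ε * n * (Real.log q / q) + (C₁ + κ + ε) * Real.log q +
        C₄ * n * 2 * (Real.log q / (q : ℝ) ^ 2) := by
  have hq2' : (2 : ℝ) ≤ q := by exact_mod_cast hq2
  have hlog : 0 ≤ Real.log q := Real.log_natCast_nonneg q
  have hsplit : Finset.Icc 1 n = insert 1 (Finset.Icc 2 n) := by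
    ext k; simp only [Finset.mem_Icc, Finset.mem_insert]; omega
  rw [hsplit, Finset.sum_insert (by simp), pow_one]
  have hdiv1 : ((n / q : ℕ) : ℝ) ≤ (n : ℝ) / q := Nat.cast_div_le
  have hdiv2 : (n : ℝ) / q - 1 ≤ ((n / q : ℕ) : ℝ) := by
    have := Nat.lt_floor_add_one ((n : ℝ) / q)
    rw [Nat.floor_div_natCast, Nat.floor_natCast] at this
    linarith
  have h1 : |F (n / q) - κ * (n / q)| ≤ ε * (n / q) + (C₁ + κ + ε) := by
    have := abs_le.1 (hF (n / q))
    have h3 : ε * ((n / q : ℕ) : ℝ) ≤ ε * (n / q) := by gcongr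
    have h4 : κ * ((n / q : ℕ) : ℝ) ≤ κ * (n / q) := by gcongr
    have h5 : κ * ((n : ℝ) / q - 1) ≤ κ * ((n / q : ℕ) : ℝ) := by gcongr
    rw [abs_le]
    constructor <;> linarith
  have h2 : ∑ k ∈ Finset.Icc 2 n, F (n / q ^ k) ≤ C₄ * n * (2 * (1 / (q : ℝ)) ^ 2) := by
    calc _ ≤ ∑ k ∈ Finset.Icc 2 n, C₄ * n * (1 / (q : ℝ)) ^ k := by
          refine Finset.sum_le_sum fun k _ => (hF4 _).trans ?_
          rw [mul_assoc]
          refine mul_le_mul_of_nonneg_left ?_ hC₄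
          refine (Nat.cast_div_le).trans (le_of_eq ?_)
          rw [Nat.cast_pow, one_div, inv_pow, div_eq_mul_inv]
      _ ≤ _ := by
          rw [← Finset.mul_sum]
          exact mul_le_mul_of_nonneg_left (sum_pow_Icc_two_le (by positivity)
            (one_div_le_one_div_of_le (by norm_num) hq2') n) (by positivity)
  have h3 : 0 ≤ ∑ k ∈ Finset.Icc 2 n, F (n / q ^ k) := Finset.sum_nonneg fun k _ => hF0 _
  generalize ∑ k ∈ Finset.Icc 2 n, F (n / q ^ k) = Z at h2 h3
  generalize F (n / q) = Y at h1
  have h4 : Real.log q * (Y + Z) - κ * (n * (Real.log q / q)) =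
      Real.log q * (Y - κ * (n / q) + Z) := by
    ring
  have h5 : ε * n * (Real.log q / q) + (C₁ + κ + ε) * Real.log q +
      C₄ * n * 2 * (Real.log q / (q : ℝ) ^ 2) = Real.log q * (ε * (n / q) + (C₁ + κ + ε) +
        C₄ * n * (2 * (1 / (q : ℝ)) ^ 2)) := by
    field_simp
  rw [h4, h5, abs_mul, abs_of_nonneg hlog]
  refine mul_le_mul_of_nonneg_left ((abs_add_le _ _).trans ?_) hlog
  rw [abs_of_nonneg h3]
  linarith

section
variable (K : Type*) [Field K] [NumberField K]
open NumberField

theorem exists_sum_log_absNorm_idealsLE_asymp {κ : ℝ} (hκ : 0 < κ)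
    (hF : ∀ ε : ℝ, 0 < ε → ∃ C : ℝ, 0 ≤ C ∧
      ∀ n : ℕ, |((idealsLE K n).card : ℝ) - κ * n| ≤ ε * n + C) {ε : ℝ} (hε : 0 < ε) :
    ∃ C : ℝ, 0 ≤ C ∧ ∀ n : ℕ, 1 ≤ n →
      |∑ I ∈ idealsLE K n, Real.log (Ideal.absNorm I) - κ * n * Real.log n| ≤
        2 * ε * n * Real.log n + C * n := by
  obtain ⟨C₁, hC₁, hF⟩ := hF ε hε
  set δ : ℝ := ε / (κ + ε) with hδ
  have hδ0 : 0 < δ := by positivity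
  have hδ1 : δ < 1 := by rw [hδ, div_lt_one (by positivity)]; linarith
  have hlogδ : 0 < -Real.log δ := neg_pos.2 (Real.log_neg hδ0 hδ1)
  refine ⟨2 * C₁ + (κ + ε + C₁) * (-Real.log δ), by positivity, fun n hn => ?_⟩
  have hn' : (1 : ℝ) ≤ n := by exact_mod_cast hn
  have hlog0 : 0 ≤ Real.log n := Real.log_nonneg hn'
  have hlogn : Real.log n ≤ n := (Real.log_le_sub_one_of_pos (by linarith)).trans (by linarith)
  have hFn := abs_le.1 (hF n)
  have hC₁n : C₁ * Real.log n ≤ C₁ * n := by gcongr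
  have hpos : ∀ I ∈ idealsLE K n, 0 < (Ideal.absNorm I : ℝ) := fun I hI => by
    exact_mod_cast Nat.pos_of_ne_zero (mt Ideal.absNorm_eq_zero_iff.1 (mem_idealsLE.1 hI).2)
  have hextra : 0 ≤ (κ + ε + C₁) * (-Real.log δ) * n := by positivity
  rw [abs_le]
  constructor
  · have hm : (⌊δ * n⌋₊ : ℝ) ≤ δ * n := Nat.floor_le (by positivity)
    have hsub : idealsLE K ⌊δ * n⌋₊ ⊆ idealsLE K n := fun I hI => by
      rw [mem_idealsLE] at hI ⊢
      refine ⟨hI.1.trans ?_, hI.2⟩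
      exact Nat.floor_le_of_le (by nlinarith)
    classical
    have hlow : ∑ I ∈ idealsLE K n \ idealsLE K ⌊δ * n⌋₊, (Real.log n + Real.log δ) ≤
        ∑ I ∈ idealsLE K n, Real.log (Ideal.absNorm I) := by
      calc _ ≤ ∑ I ∈ idealsLE K n \ idealsLE K ⌊δ * n⌋₊, Real.log (Ideal.absNorm I) := by
            refine Finset.sum_le_sum fun I hI => ?_
            rw [Finset.mem_sdiff] at hI
            have h1 : ¬ Ideal.absNorm I ≤ ⌊δ * n⌋₊ := fun h =>
              hI.2 (mem_idealsLE.2 ⟨h, (mem_idealsLE.1 hI.1).2⟩)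
            have h2 : δ * n < Ideal.absNorm I := (Nat.floor_lt (by positivity)).1 (not_le.1 h1)
            rw [← Real.log_mul (by positivity) (by positivity)]
            refine Real.log_le_log (by positivity) ?_
            linarith
        _ ≤ _ := Finset.sum_le_sum_of_subset_of_nonneg Finset.sdiff_subset
            fun I _ _ => Real.log_natCast_nonneg _
    rw [Finset.sum_const, nsmul_eq_mul, Finset.card_sdiff_of_subset hsub,
      Nat.cast_sub (Finset.card_le_card hsub)] at hlow
    have hFm := abs_le.1 (hF ⌊δ * n⌋₊)
    have h1 : ((idealsLE K ⌊δ * n⌋₊).card : ℝ) ≤ ε * n + C₁ := by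
      have : (κ + ε) * (⌊δ * n⌋₊ : ℝ) ≤ (κ + ε) * (δ * n) := by gcongr
      have h3 : (κ + ε) * (δ * n) = ε * n := by rw [hδ]; field_simp
      linarith
    have h2 : (κ * n - 2 * ε * n - 2 * C₁) * Real.log n ≤
        (((idealsLE K n).card : ℝ) - (idealsLE K ⌊δ * n⌋₊).card) * Real.log n := by
      refine mul_le_mul_of_nonneg_right ?_ hlog0
      linarith
    have h3 : (((idealsLE K n).card : ℝ) - (idealsLE K ⌊δ * n⌋₊).card) * (-Real.log δ) ≤
        ((κ + ε + C₁) * n) * (-Real.log δ) := by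
      refine mul_le_mul_of_nonneg_right ?_ hlogδ.le
      have : (0 : ℝ) ≤ (idealsLE K ⌊δ * n⌋₊).card := by positivity
      nlinarith
    linarith
  · have h1 : ∑ I ∈ idealsLE K n, Real.log (Ideal.absNorm I) ≤
        (idealsLE K n).card * Real.log n := by
      rw [← nsmul_eq_mul, ← Finset.sum_const]
      refine Finset.sum_le_sum fun I hI => Real.log_le_log (hpos I hI) ?_
      exact_mod_cast (mem_idealsLE.1 hI).1
    have h2 : ((idealsLE K n).card : ℝ) * Real.log n ≤ (κ * n + ε * n + C₁) * Real.log n := by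
      refine mul_le_mul_of_nonneg_right ?_ hlog0
      linarith
    have h3 : 0 ≤ ε * n * Real.log n := by positivity
    have h4 : 0 ≤ C₁ * n := by positivity
    linarith

theorem exists_sum_log_absNorm_idealsLE_approx {κ : ℝ} (hκ : 0 < κ)
    (hF : ∀ ε : ℝ, 0 < ε → ∃ C : ℝ, 0 ≤ C ∧
      ∀ n : ℕ, |((idealsLE K n).card : ℝ) - κ * n| ≤ ε * n + C) {ε : ℝ} (hε : 0 < ε) :
    ∃ C : ℝ, 0 ≤ C ∧ ∀ n : ℕ,
      |∑ I ∈ idealsLE K n, Real.log (Ideal.absNorm I) - κ * n *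
          ∑ P ∈ primeIdealsLE K n, Real.log (Ideal.absNorm P) / Ideal.absNorm P| ≤
        ε * n * ∑ P ∈ primeIdealsLE K n, Real.log (Ideal.absNorm P) / Ideal.absNorm P + C * n := by
  obtain ⟨C₁, hC₁, hF⟩ := hF ε hε
  obtain ⟨C₂, hC₂, hsq⟩ := exists_sum_log_absNorm_div_sq_le K
  obtain ⟨C₃, hC₃, hth⟩ := exists_sum_log_absNorm_le K
  set C₄ := κ + ε + C₁ with hC₄
  have hF4 : ∀ m : ℕ, ((idealsLE K m).card : ℝ) ≤ C₄ * m := by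
    intro m
    rcases Nat.eq_zero_or_pos m with rfl | hm
    · have : idealsLE K 0 = ∅ := by
        ext I
        simp [mem_idealsLE, Ideal.absNorm_eq_zero_iff]
      simp [this]
    · have hm' : (1 : ℝ) ≤ m := by exact_mod_cast hm
      have := (abs_le.1 (hF m)).2
      nlinarith
  refine ⟨(C₁ + κ + ε) * C₃ + C₄ * (2 * C₂), by positivity, fun n => ?_⟩
  rw [sum_log_absNorm_eq, mul_assoc κ, Finset.mul_sum, Finset.mul_sum, ← Finset.sum_sub_distrib]
  refine (Finset.abs_sum_le_sum_abs _ _).trans ?_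
  have hterm : ∀ P ∈ primeIdealsLE K n,
      |Real.log (Ideal.absNorm P) *
          ∑ k ∈ Finset.Icc 1 n, ((idealsLE K (n / Ideal.absNorm P ^ k)).card : ℝ) -
        κ * (n * (Real.log (Ideal.absNorm P) / Ideal.absNorm P))| ≤
      ε * n * (Real.log (Ideal.absNorm P) / Ideal.absNorm P) +
        (C₁ + κ + ε) * Real.log (Ideal.absNorm P) +
        C₄ * n * 2 * (Real.log (Ideal.absNorm P) / (Ideal.absNorm P : ℝ) ^ 2) := by
    intro P hP
    rw [mem_primeIdealsLE] at hP
    exact abs_log_mul_sum_sub_le (F := fun m => ((idealsLE K m).card : ℝ)) hκ.le hε.le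
      (by positivity) (fun m => by positivity) hF hF4 (two_le_absNorm hP.2.1 hP.2.2) hP.1
  refine (Finset.sum_le_sum hterm).trans ?_
  rw [Finset.sum_add_distrib, Finset.sum_add_distrib, ← Finset.mul_sum, ← Finset.mul_sum,
    ← Finset.mul_sum]
  have h1 : (C₁ + κ + ε) * ∑ P ∈ primeIdealsLE K n, Real.log (Ideal.absNorm P) ≤
      (C₁ + κ + ε) * (C₃ * n) := by gcongr; exact hth n
  have h2 : C₄ * n * 2 * ∑ P ∈ primeIdealsLE K n,
      Real.log (Ideal.absNorm P) / (Ideal.absNorm P : ℝ) ^ 2 ≤ C₄ * n * 2 * C₂ := by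
    gcongr; exact hsq n
  linarith

/-- Mertens' theorem for the prime ideals of a number field, with the main term only. -/
theorem exists_sum_log_absNorm_div_asymp {ε : ℝ} (hε : 0 < ε) :
    ∃ C : ℝ, 0 ≤ C ∧ ∀ n : ℕ, 1 ≤ n →
      |∑ P ∈ primeIdealsLE K n, Real.log (Ideal.absNorm P) / Ideal.absNorm P - Real.log n| ≤
        ε * Real.log n + C := by
  obtain ⟨κ, hκ, hF⟩ := exists_card_idealsLE_asymp K
  set η := min (κ / 2) (ε * κ / 6) with hη
  have hη0 : 0 < η := by positivity
  have hη1 : η ≤ κ / 2 := min_le_left _ _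
  have hη2 : η ≤ ε * κ / 6 := min_le_right _ _
  obtain ⟨C₁, hC₁, h1⟩ := exists_sum_log_absNorm_idealsLE_asymp K hκ hF hη0
  obtain ⟨C₂, hC₂, h2⟩ := exists_sum_log_absNorm_idealsLE_approx K hκ hF hη0
  refine ⟨2 * (C₁ + C₂) / κ, by positivity, fun n hn => ?_⟩
  have hn' : (0 : ℝ) < n := by exact_mod_cast hn
  have hlog0 : 0 ≤ Real.log n := Real.log_natCast_nonneg n
  have h1 := abs_le.1 (h1 n hn)
  have h2 := abs_le.1 (h2 n)
  set T := ∑ P ∈ primeIdealsLE K n, Real.log (Ideal.absNorm P) / Ideal.absNorm P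
  set W := ∑ I ∈ idealsLE K n, Real.log (Ideal.absNorm I)
  have h3 : κ * |T - Real.log n| ≤ η * T + 2 * η * Real.log n + (C₁ + C₂) := by
    have : n * (κ * |T - Real.log n|) ≤ n * (η * T + 2 * η * Real.log n + (C₁ + C₂)) := by
      have h : n * (κ * |T - Real.log n|) = |n * (κ * (T - Real.log n))| := by
        rw [abs_mul, abs_mul, abs_of_pos hκ, abs_of_pos hn']
      rw [h, abs_le]
      constructor <;> linarith
    exact le_of_mul_le_mul_left this hn'
  have h4 : T ≤ Real.log n + |T - Real.log n| := by
    have := le_abs_self (T - Real.log n)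
    linarith
  have h5 : η * T ≤ η * Real.log n + κ / 2 * |T - Real.log n| := by
    have := mul_le_mul_of_nonneg_left h4 hη0.le
    have := mul_le_mul_of_nonneg_right hη1 (abs_nonneg (T - Real.log n))
    linarith
  have h6 : η * Real.log n ≤ ε * κ / 6 * Real.log n := by gcongr
  have h7 : κ / 2 * |T - Real.log n| ≤ κ / 2 * (ε * Real.log n + 2 * (C₁ + C₂) / κ) := by
    have : κ / 2 * (ε * Real.log n + 2 * (C₁ + C₂) / κ) =
      κ / 2 * ε * Real.log n + (C₁ + C₂) := by field_simp
    rw [this]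
    linarith
  exact le_of_mul_le_mul_left h7 (by positivity)

theorem exists_sum_ncard_absNorm_eq_asymp {ε : ℝ} (hε : 0 < ε) :
    ∃ C : ℝ, 0 ≤ C ∧ ∀ n : ℕ, 1 ≤ n →
      |∑ p ∈ Nat.primesLE n, ({P : Ideal (𝓞 K) | Ideal.absNorm P = p}.ncard : ℝ) *
          (Real.log p / p) - Real.log n| ≤ ε * Real.log n + C := by
  classical
  obtain ⟨C₁, hC₁, h1⟩ := exists_sum_log_absNorm_div_asymp K hε
  obtain ⟨C₂, hC₂, h2⟩ := exists_sum_log_absNorm_div_le K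
  refine ⟨C₁ + C₂, by positivity, fun n hn => ?_⟩
  have h3 : ∑ P ∈ primeIdealsLE K n with (Ideal.absNorm P).Prime,
      Real.log (Ideal.absNorm P) / Ideal.absNorm P =
      ∑ p ∈ Nat.primesLE n, ({P : Ideal (𝓞 K) | Ideal.absNorm P = p}.ncard : ℝ) *
          (Real.log p / p) := by
    rw [← Finset.sum_fiberwise_of_maps_to (s := (primeIdealsLE K n).filter _)
      (t := Nat.primesLE n) (g := Ideal.absNorm)]
    · refine Finset.sum_congr rfl fun p hp => ?_
      rw [Finset.sum_congr rfl (g := fun _ => Real.log p / p), Finset.sum_const, nsmul_eq_mul]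
      · congr 2
        rw [← Set.ncard_coe_finset]
        congr 1
        ext P
        simp only [Finset.coe_filter, Set.mem_ofPred_eq, Finset.mem_filter, mem_primeIdealsLE]
        constructor
        · exact fun h => h.2
        · rintro rfl
          rw [Nat.mem_primesLE] at hp
          refine ⟨⟨⟨hp.1, ?_, ?_⟩, hp.2⟩, rfl⟩
          · rintro rfl
            exact hp.2.ne_zero (by simp)
          · exact Ideal.isPrime_of_irreducible_absNorm hp.2
      · intro P hP
        rw [(Finset.mem_filter.1 hP).2]
    · intro P hP
      rw [Finset.mem_filter, mem_primeIdealsLE] at hP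
      exact Nat.mem_primesLE.2 ⟨hP.1.1, hP.2⟩
  have h4 := Finset.sum_filter_add_sum_filter_not (primeIdealsLE K n)
    (fun P => (Ideal.absNorm P).Prime) (fun P => Real.log (Ideal.absNorm P) / Ideal.absNorm P)
  have h5 := abs_le.1 (h1 n hn)
  have h6 := h2 n
  have h7 : 0 ≤ ∑ P ∈ primeIdealsLE K n with ¬ (Ideal.absNorm P).Prime,
      Real.log (Ideal.absNorm P) / (Ideal.absNorm P : ℝ) :=
    Finset.sum_nonneg fun P _ => div_nonneg (Real.log_natCast_nonneg _) (by positivity)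
  rw [← h3, abs_le]
  constructor <;> linarith

end

open Polynomial in
theorem exists_isMaximal_of_dvd_eval_minpoly {R : Type*} [CommRing R] [IsDomain R] [CharZero R]
    {β : R} (hβ : IsIntegral ℤ β) {D : ℤ} (hD : ∀ x : R, (D : R) * x ∈ Algebra.adjoin ℤ {β})
    {p : ℕ} (hpD : ¬ (p : ℤ) ∣ D) {c : ℤ} (hc : (p : ℤ) ∣ (minpoly ℤ β).eval c) :
    ∃ P : Ideal R, P.IsMaximal ∧ (p : R) ∈ P ∧ (c : R) - β ∈ P := by
  have hne : Ideal.span {(p : R), (c : R) - β} ≠ ⊤ := by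
    intro htop
    have h1 : (1 : R) ∈ Ideal.span {(p : R), (c : R) - β} := htop ▸ Submodule.mem_top
    obtain ⟨x, y, hxy⟩ := Ideal.mem_span_pair.1 h1
    obtain ⟨P, hP⟩ := Algebra.adjoin_mem_exists_aeval ℤ β (hD x)
    obtain ⟨Q, hQ⟩ := Algebra.adjoin_mem_exists_aeval ℤ β (hD y)
    have h2 : aeval β (C D - (P * C (p : ℤ) + Q * (C c - X))) = 0 := by
      simp only [map_sub, map_add, map_mul, aeval_X, hP, hQ, aeval_C]
      simp only [algebraMap_int_eq, eq_intCast, Int.cast_natCast]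
      linear_combination (-(D : R)) * hxy
    obtain ⟨S, hS⟩ := minpoly.isIntegrallyClosed_dvd hβ h2
    have h3 := congrArg (eval c) hS
    simp only [eval_sub, eval_add, eval_mul, eval_C, eval_X, sub_self, mul_zero, add_zero] at h3
    refine hpD ?_
    have h4 : D = (minpoly ℤ β).eval c * S.eval c + P.eval c * p := by linarith
    rw [h4]
    exact dvd_add (dvd_mul_of_dvd_left hc _) (dvd_mul_left _ _)
  obtain ⟨P, hP, hle⟩ := Ideal.exists_le_maximal _ hne
  exact ⟨P, hP, hle (Ideal.subset_span (by simp)), hle (Ideal.subset_span (by simp))⟩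

section
variable {R : Type*} [CommRing R]

theorem natCast_dvd_of_intCast_mem {P : Ideal R} (hP : P ≠ ⊤) {p : ℕ} (hp : p.Prime)
    (hpP : (p : R) ∈ P) {m : ℤ} (hm : (m : R) ∈ P) : (p : ℤ) ∣ m := by
  by_contra hnd
  obtain ⟨u, v, huv⟩ := ((Nat.prime_iff_prime_int.1 hp).coprime_iff_not_dvd).2 hnd
  apply hP
  rw [Ideal.eq_top_iff_one]
  have h : (1 : R) = u * p + v * m := by
    have := congrArg (Int.cast (R := R)) huv
    push_cast at this
    exact this.symm
  rw [h]
  exact P.add_mem (P.mul_mem_left _ hpP) (P.mul_mem_left _ hm)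

theorem intCast_mem_of_natCast_dvd {P : Ideal R} {p : ℕ}
    (hpP : (p : R) ∈ P) {m : ℤ} (hm : (p : ℤ) ∣ m) : (m : R) ∈ P := by
  obtain ⟨k, rfl⟩ := hm
  push_cast
  exact P.mul_mem_right _ hpP

open Polynomial in
theorem aeval_sub_eval_mem {P : Ideal R} {β : R} {c : ℤ} (h : (c : R) - β ∈ P) (Q : ℤ[X]) :
    ((Q.eval c : ℤ) : R) - aeval β Q ∈ P := by
  have h1 : ((Q.eval c : ℤ) : R) = aeval (c : R) Q := by
    have := aeval_algebraMap_apply_eq_algebraMap_eval (A := R) c Q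
    simpa using this.symm
  rw [h1]
  rw [← eval_map_algebraMap, ← eval_map_algebraMap]
  exact Ideal.mem_of_dvd _ (sub_dvd_eval_sub _ _ _) h

theorem le_of_sub_mem {β : R} {D : ℤ} (hD : ∀ x : R, (D : R) * x ∈ Algebra.adjoin ℤ {β})
    {p : ℕ} (hp : p.Prime) (hpD : ¬ (p : ℤ) ∣ D) {c : ℤ} {P P' : Ideal (R)} (hP : P ≠ ⊤)
    (hP' : P'.IsPrime) (hpP : (p : R) ∈ P) (hpP' : (p : R) ∈ P') (hc : (c : R) - β ∈ P)
    (hc' : (c : R) - β ∈ P') : P ≤ P' := by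
  intro x hx
  obtain ⟨Q, hQ⟩ := Algebra.adjoin_mem_exists_aeval ℤ β (hD x)
  have h1 := aeval_sub_eval_mem hc Q
  have h2 := aeval_sub_eval_mem hc' Q
  rw [hQ] at h1 h2
  have h3 : ((Q.eval c : ℤ) : R) ∈ P := by
    have := P.add_mem h1 (P.mul_mem_left (D : R) hx)
    rwa [sub_add_cancel] at this
  have h4 := intCast_mem_of_natCast_dvd hpP' (natCast_dvd_of_intCast_mem hP hp hpP h3)
  have h5 : (D : R) * x ∈ P' := by
    have := P'.sub_mem h4 h2
    rwa [sub_sub_cancel] at this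
  exact (hP'.mem_or_mem h5).resolve_left fun h =>
    hpD (natCast_dvd_of_intCast_mem hP'.ne_top hp hpP' h)

end

section
variable {K : Type*} [Field K] [NumberField K]
open NumberField Polynomial

theorem exists_intCast_sub_mem {P : Ideal (𝓞 K)} {p : ℕ} (hp : p.Prime)
    (hP : Ideal.absNorm P = p) (x : 𝓞 K) : ∃ m : ℤ, (m : 𝓞 K) - x ∈ P := by
  have : Fact p.Prime := ⟨hp⟩
  have hcard : Nat.card (𝓞 K ⧸ P) = p := hP
  have h1 : (1 : 𝓞 K ⧸ P) ≠ 0 := by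
    have : Finite (𝓞 K ⧸ P) :=
      Nat.finite_of_card_ne_zero (by rw [hcard]; exact hp.ne_zero)
    have : Nontrivial (𝓞 K ⧸ P) := Finite.one_lt_card_iff_nontrivial.1 (hcard ▸ hp.one_lt)
    exact one_ne_zero
  obtain ⟨m, hm⟩ := mem_zmultiples_of_prime_card hcard h1 (g' := Ideal.Quotient.mk P x)
  refine ⟨m, ?_⟩
  rw [← Ideal.Quotient.eq, ← hm]
  simp

theorem ncard_absNorm_eq_eq_card {β : 𝓞 K} {D : ℤ}
    (hD : ∀ x : 𝓞 K, (D : 𝓞 K) * x ∈ Algebra.adjoin ℤ {β}) (A B : ℕ)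
    {p : ℕ} (hp : p.Prime) (hpD : ¬ (p : ℤ) ∣ D) (hpA : ¬ p ∣ A) :
    {P : Ideal (𝓞 K) | Ideal.absNorm P = p}.ncard =
      ((Finset.range p).filter
        (fun r => (p : ℤ) ∣ (minpoly ℤ β).eval ((A * r + B : ℕ) : ℤ))).card := by
  have hβ : IsIntegral ℤ β := Algebra.IsIntegral.isIntegral β
  have hnorm_mem : ∀ P : Ideal (𝓞 K), Ideal.absNorm P = p → (p : 𝓞 K) ∈ P := fun P hP => by
    rw [← hP]; exact Ideal.absNorm_mem P
  have hprime : ∀ P : Ideal (𝓞 K), Ideal.absNorm P = p → P.IsPrime := fun P hP =>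
    Ideal.isPrime_of_irreducible_absNorm (hP ▸ hp)
  have hres : ∀ P : Ideal (𝓞 K), Ideal.absNorm P = p →
      ∃ r, r < p ∧ (((A * r + B : ℕ) : ℤ) : 𝓞 K) - β ∈ P := by
    intro P hP
    obtain ⟨m, hm⟩ := exists_intCast_sub_mem hp hP β
    have hcop : IsCoprime (A : ℤ) p :=
      (Nat.isCoprime_iff_coprime.2 ((hp.coprime_iff_not_dvd.2 hpA).symm))
    obtain ⟨u, v, huv⟩ := hcop
    have hp0 : (0 : ℤ) < p := by exact_mod_cast hp.pos
    refine ⟨((m - B) * u % p).toNat, ?_, ?_⟩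
    · have := Int.emod_lt_of_pos ((m - B) * u) hp0
      have := Int.emod_nonneg ((m - B) * u) hp0.ne'
      omega
    · have h1 : ((((m - B) * u % p).toNat : ℕ) : ℤ) = (m - B) * u % p :=
        Int.toNat_of_nonneg (Int.emod_nonneg _ hp0.ne')
      have h2 : (p : ℤ) ∣ ((A * ((m - B) * u % p).toNat + B : ℕ) : ℤ) - m := by
        push_cast
        rw [h1]
        have h3 := Int.emod_add_mul_ediv ((m - B) * u) p
        have h4 : (m - B) * u % p = (m - B) * u - p * ((m - B) * u / p) := by linarith
        rw [h4]
        refine ⟨-(m - B) * v - A * ((m - B) * u / p), ?_⟩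
        linear_combination (m - (B : ℤ)) * huv
      have h5 := intCast_mem_of_natCast_dvd (hnorm_mem P hP) h2
      have h6 := P.add_mem h5 hm
      rw [Int.cast_sub, sub_add_sub_cancel] at h6
      exact h6
  have huniq : ∀ (c : ℤ) (P P' : Ideal (𝓞 K)), Ideal.absNorm P = p → (P' ≠ ⊤ ∧ P'.IsPrime ∧
      (p : 𝓞 K) ∈ P') → (c : 𝓞 K) - β ∈ P → (c : 𝓞 K) - β ∈ P' → P = P' := by
    intro c P P' hP hP' hc hc'
    exact le_antisymm
      (le_of_sub_mem hD hp hpD (hprime P hP).ne_top hP'.2.1 (hnorm_mem P hP) hP'.2.2 hc hc')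
      (le_of_sub_mem hD hp hpD hP'.1 (hprime P hP) hP'.2.2 (hnorm_mem P hP) hc' hc)
  have hdvd : ∀ (c : ℤ) (P : Ideal (𝓞 K)), Ideal.absNorm P = p → (c : 𝓞 K) - β ∈ P →
      (p : ℤ) ∣ (minpoly ℤ β).eval c := by
    intro c P hP hc
    have h1 := aeval_sub_eval_mem hc (minpoly ℤ β)
    rw [minpoly.aeval, sub_zero] at h1
    exact natCast_dvd_of_intCast_mem (hprime P hP).ne_top hp (hnorm_mem P hP) h1
  have hex : ∀ r ∈ (Finset.range p).filter
      (fun r => (p : ℤ) ∣ (minpoly ℤ β).eval ((A * r + B : ℕ) : ℤ)),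
      ∃ P : Ideal (𝓞 K), Ideal.absNorm P = p ∧ (((A * r + B : ℕ) : ℤ) : 𝓞 K) - β ∈ P := by
    intro r hr
    obtain ⟨P, hP, hpP, hc⟩ :=
      exists_isMaximal_of_dvd_eval_minpoly hβ hD hpD (Finset.mem_filter.1 hr).2
    refine ⟨P, ?_, hc⟩
    have hsurj : ∀ x : 𝓞 K, ∃ m : ℤ, (m : 𝓞 K) - x ∈ P := by
      intro x
      obtain ⟨Q, hQ⟩ := Algebra.adjoin_mem_exists_aeval ℤ β (hD x)
      have h1 := aeval_sub_eval_mem hc Q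
      rw [hQ] at h1
      obtain ⟨u, v, huv⟩ := ((Nat.prime_iff_prime_int.1 hp).coprime_iff_not_dvd).2 hpD
      refine ⟨v * Q.eval ((A * r + B : ℕ) : ℤ), ?_⟩
      have h2 := congrArg (Int.cast (R := 𝓞 K)) huv
      push_cast at h2
      have h3 : ((v * Q.eval ((A * r + B : ℕ) : ℤ) : ℤ) : 𝓞 K) - x =
          v * (((Q.eval ((A * r + B : ℕ) : ℤ) : ℤ) : 𝓞 K) - D * x) + (-(u * x)) * p := by
        rw [Int.cast_mul]
        linear_combination x * h2
      rw [h3]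
      exact P.add_mem (P.mul_mem_left _ h1) (P.mul_mem_left _ hpP)
    have hbij : Function.Bijective (fun i : Fin p => Ideal.Quotient.mk P ((i : ℕ) : 𝓞 K)) := by
      constructor
      · intro i j hij
        rw [Ideal.Quotient.eq] at hij
        have h1 : (((i : ℕ) - (j : ℕ) : ℤ) : 𝓞 K) ∈ P := by simpa using hij
        have h2 := natCast_dvd_of_intCast_mem hP.ne_top hp hpP h1
        have h3 := Int.eq_zero_of_abs_lt_dvd h2 (by rw [abs_lt]; omega)
        exact Fin.ext (by omega)
      · intro y
        obtain ⟨x, rfl⟩ := Ideal.Quotient.mk_surjective y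
        obtain ⟨m, hm⟩ := hsurj x
        have hp0 : (0 : ℤ) < p := by exact_mod_cast hp.pos
        have hm0 := Int.emod_nonneg m hp0.ne'
        have hm1 := Int.emod_lt_of_pos m hp0
        refine ⟨⟨(m % p).toNat, by omega⟩, ?_⟩
        rw [Ideal.Quotient.eq]
        have h1 : (((m % p).toNat : ℕ) : 𝓞 K) = ((m % p : ℤ) : 𝓞 K) := by
          rw [← Int.cast_natCast, Int.toNat_of_nonneg hm0]
        have h2 : (((m % p - m : ℤ)) : 𝓞 K) ∈ P := by
          refine intCast_mem_of_natCast_dvd hpP ⟨-(m / p), ?_⟩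
          have := Int.emod_add_mul_ediv m p
          linarith
        have h3 := P.add_mem h2 hm
        rw [h1]
        rwa [Int.cast_sub, sub_add_sub_cancel] at h3
    have := Nat.card_congr (Equiv.ofBijective _ hbij)
    rw [Nat.card_fin] at this
    exact this.symm
  rw [← Set.ncard_coe_finset]
  symm
  refine Set.ncard_congr (fun r hr => (hex r hr).choose) ?_ ?_ ?_
  · intro r hr
    exact (hex r hr).choose_spec.1
  · intro r s hr hs hrs
    have h1 := (hex r hr).choose_spec
    have h2 := (hex s hs).choose_spec
    rw [← hrs] at h2
    have h3 := Ideal.sub_mem _ h1.2 h2.2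
    rw [sub_sub_sub_cancel_right, ← Int.cast_sub] at h3
    have h4 := natCast_dvd_of_intCast_mem (hprime _ h1.1).ne_top hp (hnorm_mem _ h1.1) h3
    have h5 : (p : ℤ) ∣ A * ((r : ℤ) - s) := by
      convert h4 using 1
      push_cast
      ring
    have h6 := ((Nat.prime_iff_prime_int.1 hp).dvd_or_dvd h5).resolve_left
      (by exact_mod_cast hpA)
    have hr' := Finset.mem_range.1 (Finset.mem_filter.1 hr).1
    have hs' := Finset.mem_range.1 (Finset.mem_filter.1 hs).1
    have h7 := Int.eq_zero_of_abs_lt_dvd h6 (by rw [abs_lt]; omega)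
    omega
  · intro P hP
    obtain ⟨r, hr, hc⟩ := hres P hP
    have hmem : r ∈ (Finset.range p).filter
        (fun r => (p : ℤ) ∣ (minpoly ℤ β).eval ((A * r + B : ℕ) : ℤ)) :=
      Finset.mem_filter.2 ⟨Finset.mem_range.2 hr, hdvd _ P hP hc⟩
    refine ⟨r, hmem, ?_⟩
    have h := (hex r hmem).choose_spec
    exact huniq _ _ P h.1 ⟨(hprime P hP).ne_top, hprime P hP, hnorm_mem P hP⟩ h.2 hc

end

/-- The number of residues `r` modulo `m` with `m ∣ h(r)`. -/
def Polynomial.rootCountMod (h : Polynomial ℤ) (m : ℕ) : ℕ :=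
  ((Finset.range m).filter (fun r : ℕ => (m : ℤ) ∣ h.eval (r : ℤ))).card

section
open NumberField Polynomial
variable {K : Type*} [Field K] [NumberField K]

theorem exists_intCast_mul_mem_adjoin {β : 𝓞 K}
    (hβ : Algebra.adjoin ℚ {(β : K)} = ⊤) :
    ∃ D : ℤ, D ≠ 0 ∧ ∀ x : 𝓞 K, (D : 𝓞 K) * x ∈ Algebra.adjoin ℤ {β} := by
  let B := PowerBasis.ofAdjoinEqTop (K := ℚ) (Algebra.IsIntegral.isIntegral (β : K)) hβ
  have hgen : B.gen = (β : K) := PowerBasis.ofAdjoinEqTop_gen _ _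
  have h_int : IsIntegral ℤ B.gen := by
    rw [hgen]; exact RingOfIntegers.isIntegral_coe β
  have h1 : IsIntegral ℤ (Algebra.discr ℚ B.basis) := by
    refine Algebra.discr_isIntegral ℚ fun i => ?_
    rw [B.basis_eq_pow]
    exact h_int.pow _
  obtain ⟨D, hD⟩ := IsIntegrallyClosed.isIntegral_iff.1 h1
  have hDQ : (D : ℚ) = Algebra.discr ℚ B.basis := by simpa using hD
  refine ⟨D, ?_, fun x => ?_⟩
  · intro h0
    apply Algebra.discr_not_zero_of_basis ℚ B.basis
    rw [← hDQ, h0, Int.cast_zero]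
  · have h2 := Algebra.discr_mul_isIntegral_mem_adjoin ℚ h_int (RingOfIntegers.isIntegral_coe x)
    rw [hgen] at h2
    have h3 : Algebra.adjoin ℤ {(β : K)} =
        (Algebra.adjoin ℤ {β}).map ((algebraMap (𝓞 K) K).toIntAlgHom) := by
      rw [AlgHom.map_adjoin]
      simp
    rw [h3] at h2
    obtain ⟨y, hy, hyx⟩ := h2
    have h4 : y = (D : 𝓞 K) * x := by
      apply RingOfIntegers.coe_injective
      have : (algebraMap (𝓞 K) K) y = Algebra.discr ℚ B.basis • (x : K) := hyx
      rw [this, ← hDQ, Algebra.smul_def]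
      simp
    rw [← h4]
    exact hy

theorem exists_sum_rootCountMod_asymp {β : 𝓞 K} (hβ : Algebra.adjoin ℚ {(β : K)} = ⊤)
    {A : ℕ} (hA : A ≠ 0) (B : ℕ) {ε : ℝ} (hε : 0 < ε) : ∃ C₀ : ℝ, 0 ≤ C₀ ∧ ∀ n : ℕ, 1 ≤ n →
    |∑ p ∈ Nat.primesLE n,
      (((minpoly ℤ β).comp (C (A : ℤ) * X + C (B : ℤ))).rootCountMod p : ℝ) *
        (Real.log p / p) - Real.log n| ≤ ε * Real.log n + C₀ := by
  obtain ⟨D, hD0, hD⟩ := exists_intCast_mul_mem_adjoin hβ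
  obtain ⟨C₁, hC₁, h⟩ := exists_sum_ncard_absNorm_eq_asymp K hε
  set f : ℕ → ℝ := fun p => (((minpoly ℤ β).comp (C (A : ℤ) * X + C (B : ℤ))).rootCountMod p : ℝ) *
        (Real.log p / p) with hf
  set g : ℕ → ℝ := fun p => ({P : Ideal (𝓞 K) | Ideal.absNorm P = p}.ncard : ℝ) *
        (Real.log p / p) with hg
  set S := (A * D.natAbs).primeFactors with hS
  refine ⟨C₁ + ∑ p ∈ S, |f p - g p|, by positivity, fun n hn => ?_⟩
  have h1 : ∑ p ∈ Nat.primesLE n, |f p - g p| ≤ ∑ p ∈ S, |f p - g p| := by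
    rw [← Finset.sum_filter_add_sum_filter_not (Nat.primesLE n) (· ∈ S)]
    have h2 : ∑ p ∈ (Nat.primesLE n).filter (fun p => ¬ p ∈ S), |f p - g p| = 0 := by
      refine Finset.sum_eq_zero fun p hp => ?_
      obtain ⟨hp, hpS⟩ := Finset.mem_filter.1 hp
      have hpp := Nat.prime_of_mem_primesLE hp
      have h3 : ¬ p ∣ A * D.natAbs := fun hd => hpS (Nat.mem_primeFactors.2
        ⟨hpp, hd, mul_ne_zero hA (Int.natAbs_ne_zero.2 hD0)⟩)
      have h4 := ncard_absNorm_eq_eq_card hD A B hpp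
        (fun hd => h3 (dvd_mul_of_dvd_right (Int.natCast_dvd.1 hd) _))
        (fun hd => h3 (dvd_mul_of_dvd_left hd _))
      simp only [hf, hg, h4, rootCountMod]
      simp
    rw [h2, add_zero]
    refine Finset.sum_le_sum_of_subset_of_nonneg (fun p hp => (Finset.mem_filter.1 hp).2)
      fun _ _ _ => abs_nonneg _
  have h5 : |∑ p ∈ Nat.primesLE n, f p - ∑ p ∈ Nat.primesLE n, g p| ≤ ∑ p ∈ S, |f p - g p| := by
    rw [← Finset.sum_sub_distrib]
    exact (Finset.abs_sum_le_sum_abs _ _).trans h1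
  have h6 := h n hn
  rw [abs_le] at h5 h6 ⊢
  constructor <;> linarith [h5.1, h5.2, h6.1, h6.2]

end

section
open Polynomial Finset

theorem Nat.abs_card_Ico_filter_modEq_sub_div_le (T L r : ℕ) {m : ℕ} (hm : 0 < m) :
    |((((Ico T (T + L)).filter (fun t => t ≡ r [MOD m])).card : ℝ)) - (L : ℝ) / m| ≤ 1 := by
  have h := Nat.Ico_filter_modEq_card T (T + L) hm r
  have hm' : (0 : ℚ) < m := by exact_mod_cast hm
  set x : ℚ := (T - r) / m with hx
  have hxy : (((T + L : ℕ) : ℚ) - r) / m = x + L / m := by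
    rw [hx]; push_cast; ring
  rw [hxy] at h
  have hL : (0 : ℚ) ≤ L / m := by positivity
  rw [max_eq_left (sub_nonneg.2 (Int.ceil_mono (by linarith)))] at h
  have h1 := Int.le_ceil (x + L / m)
  have h2 := Int.ceil_lt_add_one (x + L / m)
  have h3 := Int.le_ceil x
  have h4 := Int.ceil_lt_add_one x
  have h5 : |((((Ico T (T + L)).filter (fun t => t ≡ r [MOD m])).card : ℚ)) - (L : ℚ) / m| ≤ 1 := by
    have h6 : ((((Ico T (T + L)).filter (fun t => t ≡ r [MOD m])).card : ℚ)) =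
        (⌈x + L / m⌉ : ℚ) - ⌈x⌉ := by exact_mod_cast congrArg (Int.cast (R := ℚ)) h
    rw [h6, abs_le]
    constructor <;> linarith
  have h6 := (Rat.cast_le (K := ℝ)).2 h5
  push_cast at h6
  exact h6

theorem Polynomial.dvd_eval_iff_of_modEq (h : ℤ[X]) {m r s : ℕ} (hrs : r ≡ s [MOD m]) :
    (m : ℤ) ∣ h.eval (r : ℤ) ↔ (m : ℤ) ∣ h.eval (s : ℤ) := by
  have h1 : (m : ℤ) ∣ h.eval (r : ℤ) - h.eval (s : ℤ) :=
    ((Int.natCast_modEq_iff.2 hrs).symm.dvd).trans (sub_dvd_eval_sub _ _ _)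
  exact (dvd_iff_dvd_of_dvd_sub h1)

theorem Polynomial.card_Ico_filter_dvd_eval (h : ℤ[X]) (T L : ℕ) {m : ℕ} (hm : 0 < m) :
    ((Ico T (T + L)).filter (fun t : ℕ => (m : ℤ) ∣ h.eval (t : ℤ))).card =
      ∑ r ∈ (range m).filter (fun r : ℕ => (m : ℤ) ∣ h.eval (r : ℤ)),
        ((Ico T (T + L)).filter (fun t => t ≡ r [MOD m])).card := by
  rw [card_eq_sum_card_fiberwise (f := fun t => t % m)
    (t := (range m).filter (fun r : ℕ => (m : ℤ) ∣ h.eval (r : ℤ)))]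
  · refine sum_congr rfl fun r hr => ?_
    congr 1
    obtain ⟨hr, hd⟩ := mem_filter.1 hr
    have hr := mem_range.1 hr
    ext t
    simp only [mem_filter]
    constructor
    · rintro ⟨⟨h1, h2⟩, h3⟩
      exact ⟨h1, by rw [Nat.ModEq, h3, Nat.mod_eq_of_lt hr]⟩
    · rintro ⟨h1, h2⟩
      exact ⟨⟨h1, (h.dvd_eval_iff_of_modEq h2).2 hd⟩, by
        rw [Nat.ModEq, Nat.mod_eq_of_lt hr] at h2; exact h2⟩
  · intro t ht
    simp only [coe_filter, Set.mem_ofPred_eq, mem_range] at ht ⊢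
    exact ⟨Nat.mod_lt _ hm, (h.dvd_eval_iff_of_modEq (Nat.mod_modEq t m)).2 ht.2⟩

theorem Polynomial.abs_card_Ico_filter_dvd_eval_sub_le (h : ℤ[X]) (T L : ℕ) {m : ℕ} (hm : 0 < m) :
    |((((Ico T (T + L)).filter (fun t : ℕ => (m : ℤ) ∣ h.eval (t : ℤ))).card : ℝ)) -
      h.rootCountMod m * ((L : ℝ) / m)| ≤ h.rootCountMod m := by
  rw [h.card_Ico_filter_dvd_eval T L hm, rootCountMod, ← nsmul_eq_mul, ← sum_const, Nat.cast_sum,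
    ← sum_sub_distrib]
  refine (abs_sum_le_sum_abs _ _).trans ?_
  refine (sum_le_card_nsmul _ _ 1 fun r _ =>
    Nat.abs_card_Ico_filter_modEq_sub_div_le T L r hm).trans ?_
  simp

theorem Polynomial.rootCountMod_mul_le (h : ℤ[X]) {m n : ℕ} (hm : 0 < m) (hn : 0 < n)
    (hmn : m.Coprime n) : h.rootCountMod (m * n) ≤ h.rootCountMod m * h.rootCountMod n := by
  rw [rootCountMod, rootCountMod, rootCountMod, ← card_product]
  refine card_le_card_of_injOn (fun r => (r % m, r % n)) ?_ ?_
  · intro r hr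
    simp only [coe_filter, Set.mem_ofPred_eq, mem_range, coe_product, Set.mem_prod] at hr ⊢
    exact ⟨⟨Nat.mod_lt _ hm, (h.dvd_eval_iff_of_modEq (Nat.mod_modEq r m)).2
        ((Int.natCast_dvd_natCast.2 (dvd_mul_right m n)).trans hr.2)⟩,
      ⟨Nat.mod_lt _ hn, (h.dvd_eval_iff_of_modEq (Nat.mod_modEq r n)).2
        ((Int.natCast_dvd_natCast.2 (dvd_mul_left n m)).trans hr.2)⟩⟩
  · intro r hr s hs hrs
    simp only [coe_filter, Set.mem_ofPred_eq, mem_range, Prod.mk.injEq] at hr hs hrs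
    exact Nat.ModEq.eq_of_lt_of_lt
      ((Nat.modEq_and_modEq_iff_modEq_mul hmn).1 ⟨hrs.1, hrs.2⟩) hr.1 hs.1

theorem Polynomial.rootCountMod_prime_le {h : ℤ[X]} (h0 : h ≠ 0) {p : ℕ} (hp : p.Prime) :
    h.rootCountMod p ≤ h.natDegree + h.leadingCoeff.natAbs := by
  by_cases hd : (p : ℤ) ∣ h.leadingCoeff
  · have h1 : h.rootCountMod p ≤ p := (card_filter_le _ _).trans (card_range p).le
    have h2 := Nat.le_of_dvd (Int.natAbs_pos.2 (leadingCoeff_ne_zero.2 h0)) (Int.natCast_dvd.1 hd)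
    omega
  · have : Fact p.Prime := ⟨hp⟩
    have h1 : h.map (Int.castRingHom (ZMod p)) ≠ 0 := by
      intro h1
      apply hd
      rw [← ZMod.intCast_zmod_eq_zero_iff_dvd]
      have := congrArg (fun f => f.coeff h.natDegree) h1
      simpa using this
    refine le_trans ?_ (Nat.le_add_right _ _)
    refine le_trans ?_ ((card_roots' (h.map (Int.castRingHom (ZMod p)))).trans natDegree_map_le)
    refine le_trans ?_ (Multiset.toFinset_card_le _)
    refine card_le_card_of_injOn (fun r => (r : ZMod p)) ?_ ?_
    · intro r hr
      simp only [coe_filter, Set.mem_ofPred_eq, mem_range] at hr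
      simp only [mem_coe, Multiset.mem_toFinset, mem_roots h1, IsRoot.def]
      have h2 : (r : ZMod p) = Int.castRingHom (ZMod p) (r : ℤ) := by simp
      rw [h2, eval_map, eval₂_at_apply]
      exact (ZMod.intCast_zmod_eq_zero_iff_dvd _ _).2 hr.2
    · intro r hr s hs hrs
      simp only [coe_filter, Set.mem_ofPred_eq, mem_range] at hr hs
      exact Nat.ModEq.eq_of_lt_of_lt ((ZMod.natCast_eq_natCast_iff _ _ _).1 hrs) hr.1 hs.1

theorem Polynomial.pow_dvd_sub_mul {h u v : ℤ[X]} {Δ : ℤ} (hΔ : u * h + v * derivative h = C Δ)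
    {p j : ℕ} {r s : ℤ} (hr : ((p ^ j : ℕ) : ℤ) ∣ h.eval r) (hs : ((p ^ j : ℕ) : ℤ) ∣ h.eval s) :
    ∃ e : ℤ, ((p ^ j : ℕ) : ℤ) ∣ (r - s) * (Δ + (r - s) * e) := by
  obtain ⟨k, hk⟩ := binomExpansion h s (r - s)
  rw [add_sub_cancel] at hk
  have h1 := congrArg (eval s) hΔ
  simp only [eval_add, eval_mul, eval_C] at h1
  refine ⟨v.eval s * k, ?_⟩
  have h2 : (r - s) * (Δ + (r - s) * (v.eval s * k)) =
      (v.eval s) * h.eval r + ((r - s) * u.eval s - v.eval s) * h.eval s := by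
    rw [← h1, hk]; ring
  rw [h2]
  exact dvd_add (dvd_mul_of_dvd_right hr _) (dvd_mul_of_dvd_right hs _)

theorem Polynomial.rootCountMod_pow_le_of_not_dvd {h u v : ℤ[X]} {Δ : ℤ}
    (hΔ : u * h + v * derivative h = C Δ) {p j : ℕ} (hp : p.Prime) (hj : j ≠ 0)
    (hpΔ : ¬ (p : ℤ) ∣ Δ) : h.rootCountMod (p ^ j) ≤ h.rootCountMod p := by
  have hpj : ((p : ℕ) : ℤ) ∣ ((p ^ j : ℕ) : ℤ) := Int.natCast_dvd_natCast.2 (dvd_pow_self p hj)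
  refine card_le_card_of_injOn (fun r => r % p) ?_ ?_
  · intro r hr
    simp only [coe_filter, Set.mem_ofPred_eq, mem_range] at hr ⊢
    exact ⟨Nat.mod_lt _ hp.pos, (h.dvd_eval_iff_of_modEq (Nat.mod_modEq r p)).2 (hpj.trans hr.2)⟩
  · intro r hr s hs hrs
    simp only [coe_filter, Set.mem_ofPred_eq, mem_range] at hr hs
    obtain ⟨e, he⟩ := pow_dvd_sub_mul hΔ hr.2 hs.2
    have h1 : (p : ℤ) ∣ (r : ℤ) - s := (Int.natCast_modEq_iff.2 (Nat.ModEq.symm hrs)).dvd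
    have h2 : IsCoprime ((p ^ j : ℕ) : ℤ) (Δ + ((r : ℤ) - s) * e) := by
      push_cast
      refine IsCoprime.pow_left ((Nat.prime_iff_prime_int.1 hp).coprime_iff_not_dvd.2 fun h3 => hpΔ ?_)
      exact (dvd_add_left (dvd_mul_of_dvd_left h1 _)).1 h3
    have h3 := h2.dvd_of_dvd_mul_right he
    exact Nat.ModEq.eq_of_lt_of_lt (Int.natCast_modEq_iff.1 (Int.modEq_iff_dvd.2 h3).symm) hr.1 hs.1

theorem Polynomial.rootCountMod_pow_le_of_dvd {h u v : ℤ[X]} {Δ : ℤ} (hΔ0 : Δ ≠ 0)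
    (hΔ : u * h + v * derivative h = C Δ) {p j : ℕ} (hp : p.Prime)
    (hpΔ : (p : ℤ) ∣ Δ) : h.rootCountMod (p ^ j) ≤ 2 * Δ.natAbs * (Δ.natAbs * Δ.natAbs) := by
  have hΔp : 0 < Δ.natAbs := Int.natAbs_pos.2 hΔ0
  have hple : p ≤ Δ.natAbs := Nat.le_of_dvd hΔp (Int.natCast_dvd.1 hpΔ)
  have hm : 0 < p * Δ.natAbs := Nat.mul_pos hp.pos hΔp
  set S := (range (p ^ j)).filter (fun r : ℕ => ((p ^ j : ℕ) : ℤ) ∣ h.eval (r : ℤ)) with hS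
  have key : ∀ r ∈ S, ∀ s ∈ S, r % (p * Δ.natAbs) = s % (p * Δ.natAbs) →
      ((p ^ j : ℕ) : ℤ) ∣ ((r : ℤ) - s) * Δ := by
    intro r hr s hs hrs
    obtain ⟨e, he⟩ := pow_dvd_sub_mul hΔ (mem_filter.1 hr).2 (mem_filter.1 hs).2
    have h1 : ((p * Δ.natAbs : ℕ) : ℤ) ∣ (r : ℤ) - s :=
      (Int.natCast_modEq_iff.2 (Nat.ModEq.symm hrs)).dvd
    have h2 : (p : ℤ) * Δ ∣ (r : ℤ) - s := by
      refine dvd_trans ?_ h1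
      push_cast
      exact mul_dvd_mul_left _ (self_dvd_abs Δ)
    obtain ⟨f, hf⟩ := h2
    have h3 : ((r : ℤ) - s) * (Δ + ((r : ℤ) - s) * e) =
        (((r : ℤ) - s) * Δ) * (1 + p * (f * e)) := by
      have : Δ + ((r : ℤ) - s) * e = Δ * (1 + p * (f * e)) := by rw [hf]; ring
      rw [this]; ring
    rw [h3] at he
    refine IsCoprime.dvd_of_dvd_mul_right ?_ he
    push_cast
    exact IsCoprime.pow_left ⟨-(f * e), 1, by ring⟩
  have hfib : ∀ c ∈ S.image (fun r => r % (p * Δ.natAbs)),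
      (S.filter (fun r => r % (p * Δ.natAbs) = c)).card ≤ 2 * Δ.natAbs := by
    intro c hc
    obtain ⟨s, hs, rfl⟩ := mem_image.1 hc
    have hpj : (0 : ℤ) < ((p ^ j : ℕ) : ℤ) := by exact_mod_cast pow_pos hp.pos j
    have hcard : (Ioc (-(Δ.natAbs : ℤ)) Δ.natAbs).card = 2 * Δ.natAbs := by
      rw [Int.card_Ioc]; omega
    rw [← hcard]
    refine card_le_card_of_injOn (fun r : ℕ => (((r : ℤ) - s) * Δ) / ((p ^ j : ℕ) : ℤ)) ?_ ?_
    · intro r hr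
      obtain ⟨hr, hrs⟩ := mem_filter.1 hr
      obtain ⟨k, hk⟩ := key r hr s hs hrs
      simp only [hk, Int.mul_ediv_cancel_left _ hpj.ne']
      have h1 : |(r : ℤ) - s| < ((p ^ j : ℕ) : ℤ) := by
        have := mem_range.1 (mem_filter.1 hr).1
        have := mem_range.1 (mem_filter.1 hs).1
        rw [abs_lt]; omega
      have h2 : ((p ^ j : ℕ) : ℤ) * |k| < ((p ^ j : ℕ) : ℤ) * |Δ| := by
        have h3 := congrArg abs hk
        rw [abs_mul, abs_mul, abs_of_pos hpj] at h3
        rw [← h3]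
        exact mul_lt_mul_of_pos_right h1 (abs_pos.2 hΔ0)
      have h3 := abs_lt.1 (lt_of_mul_lt_mul_left h2 hpj.le)
      rw [mem_coe, mem_Ioc]
      rw [Int.natCast_natAbs]
      exact ⟨h3.1, h3.2.le⟩
    · intro r hr t ht hrt
      obtain ⟨hr, hrs⟩ := mem_filter.1 hr
      obtain ⟨ht, hts⟩ := mem_filter.1 ht
      have h1 := (Int.ediv_left_inj (key r hr s hs hrs) (key t ht s hs hts)).1 hrt
      have h2 := mul_right_cancel₀ hΔ0 h1
      omega
  calc h.rootCountMod (p ^ j) = S.card := rfl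
    _ ≤ 2 * Δ.natAbs * (S.image (fun r => r % (p * Δ.natAbs))).card := card_le_mul_card_image S _ hfib
    _ ≤ 2 * Δ.natAbs * (Δ.natAbs * Δ.natAbs) := by
      gcongr
      refine (card_le_card (t := range (p * Δ.natAbs)) ?_).trans ?_
      · intro c hc
        obtain ⟨s, hs, rfl⟩ := mem_image.1 hc
        exact mem_range.2 (Nat.mod_lt _ hm)
      · rw [card_range]
        gcongr

theorem Polynomial.exists_rootCountMod_pow_le {h u v : ℤ[X]} {Δ : ℤ} (h0 : h ≠ 0) (hΔ0 : Δ ≠ 0)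
    (hΔ : u * h + v * derivative h = C Δ) : ∃ c : ℝ, 1 ≤ c ∧ ∀ p j : ℕ, p.Prime → j ≠ 0 →
      (h.rootCountMod (p ^ j) : ℝ) ≤ c := by
  refine ⟨((h.natDegree + h.leadingCoeff.natAbs + 2 * Δ.natAbs * (Δ.natAbs * Δ.natAbs) + 1 : ℕ) : ℝ),
    by exact_mod_cast Nat.le_add_left _ _, fun p j hp hj => ?_⟩
  rw [Nat.cast_le]
  by_cases hd : (p : ℤ) ∣ Δ
  · have := rootCountMod_pow_le_of_dvd hΔ0 hΔ (j := j) hp hd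
    omega
  · have := rootCountMod_pow_le_of_not_dvd hΔ hp hj hd
    have := rootCountMod_prime_le h0 hp
    omega

end

section
open Polynomial Finset

/-- The sum of `log p` over the primes `p ≤ n` dividing `h(t)`. -/
noncomputable def Polynomial.logPrimeSum (h : ℤ[X]) (n t : ℕ) : ℝ :=
  ∑ p ∈ Nat.primesLE n, if (p : ℤ) ∣ h.eval (t : ℤ) then Real.log p else 0

/-- The sum of `ρ(p) log p / p` over the primes `p ≤ n`, with `ρ(p)` the number of roots of `h`
modulo `p`. -/
noncomputable def Polynomial.mertensSum (h : ℤ[X]) (n : ℕ) : ℝ :=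
  ∑ p ∈ Nat.primesLE n, (h.rootCountMod p : ℝ) * (Real.log p / p)

/-- The sum of `ρ(p) log² p / p` over the primes `p ≤ n`, with `ρ(p)` the number of roots of `h`
modulo `p`. -/
noncomputable def Polynomial.mertensSqSum (h : ℤ[X]) (n : ℕ) : ℝ :=
  ∑ p ∈ Nat.primesLE n, (h.rootCountMod p : ℝ) * (Real.log p ^ 2 / p)

theorem Nat.sum_primesLE_log_le (n : ℕ) : ∑ p ∈ Nat.primesLE n, Real.log p ≤ 2 * n := by
  rw [← Chebyshev.theta_eq_sum_primesLE_log]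
  refine (Chebyshev.theta_le_log4_mul_x (Nat.cast_nonneg n)).trans ?_
  have : Real.log 4 ≤ 2 := by
    have h4 : (4 : ℝ) = 2 ^ 2 := by norm_num
    rw [h4, Real.log_pow]
    have := Real.log_two_lt_d9
    push_cast
    linarith
  gcongr

theorem Polynomial.card_Ico_filter_dvd_eval_le (h : ℤ[X]) (T L : ℕ) {m : ℕ} (hm : 0 < m) :
    ((((Ico T (T + L)).filter (fun t : ℕ => (m : ℤ) ∣ h.eval (t : ℤ))).card : ℝ)) ≤
      h.rootCountMod m * ((L : ℝ) / m + 1) := by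
  have := (abs_le.1 (h.abs_card_Ico_filter_dvd_eval_sub_le T L hm)).2
  linarith

variable {h : ℤ[X]} {c : ℝ}

theorem Polynomial.sum_rootCountMod_mul_log_le
    (hc : ∀ p : ℕ, p.Prime → (h.rootCountMod p : ℝ) ≤ c) (n : ℕ) :
    ∑ p ∈ Nat.primesLE n, (h.rootCountMod p : ℝ) * Real.log p ≤ 2 * c * n := by
  have hc0 : 0 ≤ c := (Nat.cast_nonneg _).trans (hc 2 Nat.prime_two)
  calc _ ≤ ∑ p ∈ Nat.primesLE n, c * Real.log p := by
        refine sum_le_sum fun p hp => ?_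
        gcongr
        exact hc p (Nat.prime_of_mem_primesLE hp)
    _ ≤ c * (2 * n) := by
        rw [← mul_sum]
        gcongr
        exact Nat.sum_primesLE_log_le n
    _ = 2 * c * n := by ring

theorem Polynomial.abs_sum_logPrimeSum_sub_le
    (hc : ∀ p : ℕ, p.Prime → (h.rootCountMod p : ℝ) ≤ c) (n T L : ℕ) :
    |∑ t ∈ Ico T (T + L), h.logPrimeSum n t - L * h.mertensSum n| ≤ 2 * c * n := by
  refine le_trans ?_ (sum_rootCountMod_mul_log_le hc n)
  simp only [logPrimeSum, mertensSum]
  rw [sum_comm, mul_sum, ← sum_sub_distrib]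
  refine (abs_sum_le_sum_abs _ _).trans (sum_le_sum fun p hp => ?_)
  have h1 := h.abs_card_Ico_filter_dvd_eval_sub_le T L (Nat.prime_of_mem_primesLE hp).pos
  rw [← sum_filter, sum_const, nsmul_eq_mul]
  have h2 : ((((Ico T (T + L)).filter (fun t : ℕ => (p : ℤ) ∣ h.eval (t : ℤ))).card : ℝ)) *
      Real.log p - L * (h.rootCountMod p * (Real.log p / p)) =
      (((((Ico T (T + L)).filter (fun t : ℕ => (p : ℤ) ∣ h.eval (t : ℤ))).card : ℝ)) -
      h.rootCountMod p * ((L : ℝ) / p)) * Real.log p := by ring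
  have hlog := Real.log_natCast_nonneg p
  rw [h2, abs_mul, abs_of_nonneg hlog]
  gcongr

theorem Polynomial.sum_logPrimeSum_mul_le (T L : ℕ) {p p' : ℕ} (hp : p.Prime) (hp' : p'.Prime) :
    ∑ t ∈ Ico T (T + L), (if (p : ℤ) ∣ h.eval (t : ℤ) then Real.log p else 0) *
      (if (p' : ℤ) ∣ h.eval (t : ℤ) then Real.log p' else 0) ≤
    L * ((h.rootCountMod p * (Real.log p / p)) * (h.rootCountMod p' * (Real.log p' / p'))) +
      (h.rootCountMod p * Real.log p) * (h.rootCountMod p' * Real.log p') +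
      (if p = p' then L * (h.rootCountMod p * (Real.log p ^ 2 / p)) +
        h.rootCountMod p * Real.log p ^ 2 else 0) := by
  have hlog := Real.log_natCast_nonneg p
  have hlog' := Real.log_natCast_nonneg p'
  by_cases hpp : p = p'
  · subst hpp
    have h1 : ∀ t : ℕ, (if (p : ℤ) ∣ h.eval (t : ℤ) then Real.log p else 0) *
        (if (p : ℤ) ∣ h.eval (t : ℤ) then Real.log p else 0) =
        if (p : ℤ) ∣ h.eval (t : ℤ) then Real.log p ^ 2 else 0 := by
      intro t; split_ifs <;> ring
    simp only [h1]
    rw [← sum_filter, sum_const, nsmul_eq_mul, if_pos trivial]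
    have h2 := h.card_Ico_filter_dvd_eval_le T L hp.pos
    have h3 := mul_le_mul_of_nonneg_right h2 (sq_nonneg (Real.log p))
    have h4 : (0 : ℝ) ≤ L * ((h.rootCountMod p * (Real.log p / p)) *
      (h.rootCountMod p * (Real.log p / p))) +
      (h.rootCountMod p * Real.log p) * (h.rootCountMod p * Real.log p) := by positivity
    have h5 : (h.rootCountMod p : ℝ) * ((L : ℝ) / p + 1) * Real.log p ^ 2 =
      L * (h.rootCountMod p * (Real.log p ^ 2 / p)) + h.rootCountMod p * Real.log p ^ 2 := by ring
    linarith
  · have hcop : p.Coprime p' := (Nat.coprime_primes hp hp').2 hpp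
    have h1 : ∀ t : ℕ, (if (p : ℤ) ∣ h.eval (t : ℤ) then Real.log p else 0) *
        (if (p' : ℤ) ∣ h.eval (t : ℤ) then Real.log p' else 0) =
        if ((p * p' : ℕ) : ℤ) ∣ h.eval (t : ℤ) then Real.log p * Real.log p' else 0 := by
      intro t
      have h2 : ((p * p' : ℕ) : ℤ) ∣ h.eval (t : ℤ) ↔
          (p : ℤ) ∣ h.eval (t : ℤ) ∧ (p' : ℤ) ∣ h.eval (t : ℤ) := by
        push_cast
        constructor
        · exact fun hd => ⟨(dvd_mul_right _ _).trans hd, (dvd_mul_left _ _).trans hd⟩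
        · exact fun hd => (Nat.isCoprime_iff_coprime.2 hcop).mul_dvd hd.1 hd.2
      simp only [h2]
      split_ifs <;> simp_all
    simp only [h1]
    rw [← sum_filter, sum_const, nsmul_eq_mul, if_neg hpp, add_zero]
    have h2 := h.card_Ico_filter_dvd_eval_le T L (Nat.mul_pos hp.pos hp'.pos)
    have h3 : (h.rootCountMod (p * p') : ℝ) ≤ h.rootCountMod p * h.rootCountMod p' := by
      exact_mod_cast h.rootCountMod_mul_le hp.pos hp'.pos hcop
    have h4 : (h.rootCountMod (p * p') : ℝ) * ((L : ℝ) / (p * p' : ℕ) + 1) ≤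
        h.rootCountMod p * h.rootCountMod p' * ((L : ℝ) / (p * p' : ℕ) + 1) := by gcongr
    have h5 := mul_le_mul_of_nonneg_right (h2.trans h4) (mul_nonneg hlog hlog')
    refine h5.trans (le_of_eq ?_)
    push_cast
    have : (p : ℝ) ≠ 0 := by exact_mod_cast hp.ne_zero
    have : (p' : ℝ) ≠ 0 := by exact_mod_cast hp'.ne_zero
    field_simp

theorem Polynomial.sum_logPrimeSum_sq_le
    (hc : ∀ p : ℕ, p.Prime → (h.rootCountMod p : ℝ) ≤ c) (n T L : ℕ) :
    ∑ t ∈ Ico T (T + L), h.logPrimeSum n t ^ 2 ≤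
      L * h.mertensSum n ^ 2 + L * h.mertensSqSum n + (4 * c ^ 2 + 2 * c) * n ^ 2 := by
  have hc0 : 0 ≤ c := (Nat.cast_nonneg _).trans (hc 2 Nat.prime_two)
  set F : ℕ → ℝ := fun p => h.rootCountMod p * Real.log p with hF
  have h1 : ∑ t ∈ Ico T (T + L), h.logPrimeSum n t ^ 2 =
      ∑ p ∈ Nat.primesLE n, ∑ p' ∈ Nat.primesLE n, ∑ t ∈ Ico T (T + L),
        (if (p : ℤ) ∣ h.eval (t : ℤ) then Real.log p else 0) *
        (if (p' : ℤ) ∣ h.eval (t : ℤ) then Real.log p' else 0) := by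
    simp only [logPrimeSum, sq, sum_mul_sum]
    rw [sum_comm]
    exact sum_congr rfl fun p _ => sum_comm
  rw [h1]
  have h2 : ∑ p ∈ Nat.primesLE n, ∑ p' ∈ Nat.primesLE n, ∑ t ∈ Ico T (T + L),
        (if (p : ℤ) ∣ h.eval (t : ℤ) then Real.log p else 0) *
        (if (p' : ℤ) ∣ h.eval (t : ℤ) then Real.log p' else 0) ≤
      ∑ p ∈ Nat.primesLE n, ∑ p' ∈ Nat.primesLE n,
        (L * ((h.rootCountMod p * (Real.log p / p)) * (h.rootCountMod p' * (Real.log p' / p'))) +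
      F p * F p' +
      (if p = p' then L * (h.rootCountMod p * (Real.log p ^ 2 / p)) +
        h.rootCountMod p * Real.log p ^ 2 else 0)) := by
    refine sum_le_sum fun p hp => sum_le_sum fun p' hp' => ?_
    exact sum_logPrimeSum_mul_le T L (Nat.prime_of_mem_primesLE hp)
      (Nat.prime_of_mem_primesLE hp')
  have h3 : ∑ p ∈ Nat.primesLE n, ∑ p' ∈ Nat.primesLE n,
        (L * ((h.rootCountMod p * (Real.log p / p)) * (h.rootCountMod p' * (Real.log p' / p'))) +
      F p * F p' +
      (if p = p' then L * (h.rootCountMod p * (Real.log p ^ 2 / p)) +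
        h.rootCountMod p * Real.log p ^ 2 else 0)) =
      L * h.mertensSum n ^ 2 + (∑ p ∈ Nat.primesLE n, F p) ^ 2 + (L * h.mertensSqSum n +
        ∑ p ∈ Nat.primesLE n, F p * Real.log p) := by
    simp only [sum_add_distrib, ← mul_sum, ← sum_mul, sum_ite_eq, mertensSum, mertensSqSum, sq]
    congr 1
    rw [sum_congr rfl fun p hp => if_pos hp, sum_add_distrib, ← mul_sum]
    congr 1
    exact sum_congr rfl fun p _ => by rw [hF]; ring
  have hF0 : ∀ p, 0 ≤ F p := fun p => mul_nonneg (Nat.cast_nonneg _) (Real.log_natCast_nonneg p)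
  have h4 : ∑ p ∈ Nat.primesLE n, F p ≤ 2 * c * n := sum_rootCountMod_mul_log_le hc n
  have h5 : ∑ p ∈ Nat.primesLE n, F p * Real.log p ≤ 2 * c * n * n := by
    calc _ ≤ ∑ p ∈ Nat.primesLE n, F p * n := by
          refine sum_le_sum fun p hp => mul_le_mul_of_nonneg_left ?_ (hF0 p)
          have h6 := Real.log_le_self (Nat.cast_nonneg (α := ℝ) p)
          exact h6.trans (Nat.cast_le.2 (Nat.le_of_mem_primesLE hp))
      _ ≤ 2 * c * n * n := by
          rw [← sum_mul]
          gcongr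
  have h6 : (∑ p ∈ Nat.primesLE n, F p) ^ 2 ≤ (2 * c * n) ^ 2 :=
    pow_le_pow_left₀ (sum_nonneg fun p _ => hF0 p) h4 2
  nlinarith [h2, h3, h5, h6]

theorem Polynomial.mertensSqSum_pow_le (h : ℤ[X]) {w : ℕ} (hw : 1 ≤ w) (k : ℕ) :
    h.mertensSqSum (w ^ k) ≤
      Real.log w * (k * h.mertensSum (w ^ k) - ∑ i ∈ range k, h.mertensSum (w ^ i)) := by
  induction k with
  | zero => simp [mertensSqSum]
  | succ k ih =>
    have hsub : Nat.primesLE (w ^ k) ⊆ Nat.primesLE (w ^ (k + 1)) :=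
      Nat.primesLE_mono (Nat.pow_le_pow_right hw (Nat.le_succ k))
    have h1 : h.mertensSqSum (w ^ (k + 1)) - h.mertensSqSum (w ^ k) ≤
        (k + 1) * Real.log w * (h.mertensSum (w ^ (k + 1)) - h.mertensSum (w ^ k)) := by
      simp only [mertensSqSum, mertensSum]
      rw [← sum_sdiff hsub, ← sum_sdiff hsub, add_sub_cancel_right, add_sub_cancel_right, mul_sum]
      refine sum_le_sum fun p hp => ?_
      have hp := (mem_sdiff.1 hp).1
      have hlog := Real.log_natCast_nonneg p
      have h2 : Real.log p ≤ (k + 1) * Real.log w := by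
        have h3 : (p : ℝ) ≤ (w : ℝ) ^ (k + 1) := by exact_mod_cast Nat.le_of_mem_primesLE hp
        have h4 := Real.log_le_log
          (by exact_mod_cast (Nat.prime_of_mem_primesLE hp).pos) h3
        rw [Real.log_pow] at h4
        exact_mod_cast h4
      calc (h.rootCountMod p : ℝ) * (Real.log p ^ 2 / p)
          = Real.log p * (h.rootCountMod p * (Real.log p / p)) := by ring
        _ ≤ _ := by gcongr
    rw [sum_range_succ]
    push_cast
    linarith

end

section
open Polynomial Finset

/-- The sum of `log p` over the prime powers `p ^ j ≤ H` dividing `h(t)` with `p ≤ P` and `2 ≤ j`. -/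
noncomputable def Polynomial.logPrimePowSum (h : ℤ[X]) (P H t : ℕ) : ℝ :=
  ∑ p ∈ Nat.primesLE P, ∑ j ∈ Icc 2 (Nat.log p H),
    if ((p ^ j : ℕ) : ℤ) ∣ h.eval (t : ℤ) then Real.log p else 0

theorem Nat.factorization_mul_log_le {n H p : ℕ} (hn : n ≠ 0) (hnH : n ≤ H) (hp : p.Prime) :
    n.factorization p * Real.log p ≤ (if p ∣ n then Real.log p else 0) +
      ∑ j ∈ Icc 2 (Nat.log p H), if p ^ j ∣ n then Real.log p else 0 := by
  have hlog := Real.log_natCast_nonneg p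
  by_cases hpn : p ∣ n
  · rw [if_pos hpn]
    have h1 : Icc 2 (n.factorization p) ⊆ (Icc 2 (Nat.log p H)).filter (fun j => p ^ j ∣ n) := by
      intro j hj
      obtain ⟨hj2, hj⟩ := mem_Icc.1 hj
      have hd : p ^ j ∣ n := (hp.pow_dvd_iff_le_factorization hn).2 hj
      exact mem_filter.2 ⟨mem_Icc.2 ⟨hj2, Nat.le_log_of_pow_le hp.one_lt
        ((Nat.le_of_dvd (Nat.pos_of_ne_zero hn) hd).trans hnH)⟩, hd⟩
    have h2 := card_le_card h1
    rw [Nat.card_Icc] at h2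
    rw [← sum_filter, sum_const, nsmul_eq_mul]
    have h3 : (n.factorization p : ℝ) ≤
        1 + (((Icc 2 (Nat.log p H)).filter (fun j => p ^ j ∣ n)).card : ℝ) := by
      have : n.factorization p ≤ 1 + ((Icc 2 (Nat.log p H)).filter (fun j => p ^ j ∣ n)).card := by
        omega
      exact_mod_cast this
    nlinarith
  · rw [Nat.factorization_eq_zero_of_not_dvd hpn]
    have : 0 ≤ ∑ j ∈ Icc 2 (Nat.log p H), if p ^ j ∣ n then Real.log p else 0 :=
      sum_nonneg fun j _ => by split_ifs <;> simp [hlog]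
    simpa [hpn] using this

theorem Polynomial.log_abs_eval_le (h : ℤ[X]) {P H t : ℕ} (h0 : h.eval (t : ℤ) ≠ 0)
    (hH : |h.eval (t : ℤ)| ≤ H) (hP : ∀ p : ℕ, p.Prime → (p : ℤ) ∣ h.eval (t : ℤ) → p ≤ P) :
    Real.log |((h.eval (t : ℤ) : ℤ) : ℝ)| ≤ h.logPrimeSum P t + h.logPrimePowSum P H t := by
  set n := (h.eval (t : ℤ)).natAbs with hn
  have hn0 : n ≠ 0 := Int.natAbs_ne_zero.2 h0
  have hnH : n ≤ H := by
    have : ((n : ℕ) : ℤ) ≤ H := by rw [hn, Int.natCast_natAbs]; exact hH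
    exact_mod_cast this
  have h1 : |((h.eval (t : ℤ) : ℤ) : ℝ)| = (n : ℝ) := by
    rw [hn, Nat.cast_natAbs, Int.cast_abs]
  rw [h1, Real.log_nat_eq_sum_factorization, Finsupp.sum, logPrimeSum, logPrimePowSum,
    ← sum_add_distrib]
  have h2 : n.factorization.support ⊆ Nat.primesLE P := by
    intro p hp
    rw [Nat.support_factorization] at hp
    have hpp := Nat.prime_of_mem_primeFactors hp
    exact Nat.mem_primesLE.2
      ⟨hP p hpp (Int.natCast_dvd.2 (Nat.dvd_of_mem_primeFactors hp)), hpp⟩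
  refine (sum_le_sum_of_subset_of_nonneg h2 fun p _ _ =>
    mul_nonneg (Nat.cast_nonneg _) (Real.log_natCast_nonneg p)).trans (sum_le_sum fun p hp => ?_)
  refine (Nat.factorization_mul_log_le hn0 hnH (Nat.prime_of_mem_primesLE hp)).trans (le_of_eq ?_)
  simp only [Int.natCast_dvd, hn]

theorem Nat.card_primesLE_mul_log_le (n : ℕ) :
    ((Nat.primesLE n).card : ℝ) * Real.log n ≤ 6 * n := by
  rcases Nat.lt_or_ge 1 n with hn | hn
  · have hn' : (1 : ℝ) < n := by exact_mod_cast hn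
    have h1 := Chebyshev.pi_le_log4_mul_div hn'
    rw [Nat.floor_natCast] at h1
    rw [Nat.primesLE_card_eq_primeCounting]
    have hlog : 0 < Real.log n := Real.log_pos hn'
    have h2 : Real.log (√(n : ℝ)) = Real.log n / 2 := Real.log_sqrt (Nat.cast_nonneg n)
    have h3 : Real.log n ≤ 2 * √(n : ℝ) := by
      have := Real.log_le_self (Real.sqrt_nonneg (n : ℝ))
      linarith
    have h4 : Real.log 4 ≤ 2 := by
      have h4 : (4 : ℝ) = 2 ^ 2 := by norm_num
      rw [h4, Real.log_pow]
      have := Real.log_two_lt_d9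
      push_cast
      linarith
    rw [h2] at h1
    have h5 := mul_le_mul_of_nonneg_right h1 hlog.le
    have h6 : (Real.log 4 * n / (Real.log n / 2) + √(n : ℝ)) * Real.log n =
        2 * (Real.log 4 * n) + √(n : ℝ) * Real.log n := by
      field_simp
    rw [h6] at h5
    have h7 : √(n : ℝ) * Real.log n ≤ √(n : ℝ) * (2 * √(n : ℝ)) := by gcongr
    have h8 : √(n : ℝ) * √(n : ℝ) = n := Real.mul_self_sqrt (Nat.cast_nonneg n)
    have h9 : Real.log 4 * n ≤ 2 * n := by gcongr
    linarith
  · have : Real.log n = 0 := by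
      interval_cases n <;> simp
    rw [this, mul_zero]
    positivity

theorem Polynomial.exists_sum_logPrimePowSum_le {h : ℤ[X]} {c : ℝ}
    (hc : ∀ p j : ℕ, p.Prime → j ≠ 0 → (h.rootCountMod (p ^ j) : ℝ) ≤ c) :
    ∃ C : ℝ, 0 ≤ C ∧ ∀ P e T L : ℕ, ∑ t ∈ Ico T (T + L), h.logPrimePowSum P (P ^ e) t ≤
      C * (L + e * P) := by
  have hc0 : 0 ≤ c := (Nat.cast_nonneg _).trans (hc 2 1 Nat.prime_two one_ne_zero)
  obtain ⟨C, hC, hCle⟩ := exists_sum_primesLE_rpow_le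
  refine ⟨c * (4 * C + 6), by positivity, fun P e T L => ?_⟩
  have h1 : ∑ t ∈ Ico T (T + L), h.logPrimePowSum P (P ^ e) t =
      ∑ p ∈ Nat.primesLE P, ∑ j ∈ Icc 2 (Nat.log p (P ^ e)), ∑ t ∈ Ico T (T + L),
        if ((p ^ j : ℕ) : ℤ) ∣ h.eval (t : ℤ) then Real.log p else 0 := by
    simp only [logPrimePowSum]
    rw [sum_comm]
    exact sum_congr rfl fun p _ => sum_comm
  rw [h1]
  have h2 : ∀ p ∈ Nat.primesLE P, ∑ j ∈ Icc 2 (Nat.log p (P ^ e)), ∑ t ∈ Ico T (T + L),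
        (if ((p ^ j : ℕ) : ℤ) ∣ h.eval (t : ℤ) then Real.log p else 0) ≤
      c * (4 * L * (p : ℝ) ^ (-(3 / 2 : ℝ)) + e * Real.log P) := by
    intro p hp
    have hpp := Nat.prime_of_mem_primesLE hp
    have hp1 : (1 : ℝ) ≤ p := by exact_mod_cast hpp.one_le
    have hp2 : (2 : ℝ) ≤ p := by exact_mod_cast hpp.two_le
    have hlog := Real.log_natCast_nonneg p
    have h3 : ∀ j ∈ Icc 2 (Nat.log p (P ^ e)), ∑ t ∈ Ico T (T + L),
        (if ((p ^ j : ℕ) : ℤ) ∣ h.eval (t : ℤ) then Real.log p else 0) ≤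
        c * L * Real.log p * (1 / (p : ℝ)) ^ j + c * Real.log p := by
      intro j hj
      have hj := mem_Icc.1 hj
      rw [← sum_filter, sum_const, nsmul_eq_mul]
      have h4 := h.card_Ico_filter_dvd_eval_le T L (pow_pos hpp.pos j)
      have h5 : (h.rootCountMod (p ^ j) : ℝ) * ((L : ℝ) / (p ^ j : ℕ) + 1) ≤
          c * ((L : ℝ) / (p ^ j : ℕ) + 1) := by
        gcongr
        exact hc p j hpp (by omega)
      refine (mul_le_mul_of_nonneg_right (h4.trans h5) hlog).trans (le_of_eq ?_)
      push_cast
      rw [one_div, inv_pow]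
      ring
    refine (sum_le_sum h3).trans ?_
    rw [sum_add_distrib, ← mul_sum, sum_const, nsmul_eq_mul, Nat.card_Icc]
    have h6 := sum_pow_Icc_two_le (x := 1 / (p : ℝ)) (by positivity)
      (one_div_le_one_div_of_le (by norm_num) hp2) (Nat.log p (P ^ e))
    have h7 := Real.log_div_sq_le_rpow hp1
    have h8 : ((Nat.log p (P ^ e) + 1 - 2 : ℕ) : ℝ) * Real.log p ≤ e * Real.log P := by
      have h9 : Nat.log p (P ^ e) + 1 - 2 ≤ Nat.log p (P ^ e) := by omega
      have hP0 : P ≠ 0 := by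
        have := Nat.le_of_mem_primesLE hp
        have := hpp.pos
        omega
      have h10 : (p : ℝ) ^ Nat.log p (P ^ e) ≤ (P : ℝ) ^ e := by
        exact_mod_cast Nat.pow_log_le_self p (pow_ne_zero e hP0)
      have h11 := Real.log_le_log (by positivity) h10
      rw [Real.log_pow, Real.log_pow] at h11
      refine le_trans ?_ h11
      gcongr
    calc _ ≤ c * L * Real.log p * (2 * (1 / (p : ℝ)) ^ 2) + c * (e * Real.log P) := by
          refine add_le_add (by gcongr) ?_
          calc _ = c * (((Nat.log p (P ^ e) + 1 - 2 : ℕ) : ℝ) * Real.log p) := mul_left_comm _ _ _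
            _ ≤ _ := mul_le_mul_of_nonneg_left h8 hc0
      _ = c * (2 * L * (Real.log p / p ^ 2) + e * Real.log P) := by
          rw [one_div, inv_pow]; ring
      _ ≤ c * (2 * L * (2 * (p : ℝ) ^ (-(3 / 2 : ℝ))) + e * Real.log P) := by gcongr
      _ = _ := by ring
  refine (sum_le_sum h2).trans ?_
  rw [← mul_sum, sum_add_distrib, ← mul_sum, sum_const, nsmul_eq_mul]
  have h12 := Nat.card_primesLE_mul_log_le P
  have h13 := hCle P
  calc c * (4 * L * ∑ p ∈ Nat.primesLE P, (p : ℝ) ^ (-(3 / 2 : ℝ)) +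
        (Nat.primesLE P).card * (e * Real.log P))
      = c * (4 * L * ∑ p ∈ Nat.primesLE P, (p : ℝ) ^ (-(3 / 2 : ℝ)) +
        e * ((Nat.primesLE P).card * Real.log P)) := by ring
    _ ≤ c * (4 * L * C + e * (6 * P)) := by gcongr
    _ ≤ c * (4 * C + 6) * (L + e * P) := by
        have : 0 ≤ c * (6 * L + 4 * C * (e * P)) := by positivity
        linarith

end

section
open Polynomial Finset

theorem Nat.exists_le_pow_le_lt_succ_pow {k W L : ℕ} (hk : k ≠ 0) (hL : W ^ k ≤ L) :
    ∃ w, W ≤ w ∧ w ^ k ≤ L ∧ L < (w + 1) ^ k := by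
  have hb : ∀ w, w ^ k ≤ L → w ≤ L := fun w hw => (Nat.le_self_pow hk w).trans hw
  refine ⟨Nat.findGreatest (fun w => w ^ k ≤ L) L, Nat.le_findGreatest (hb W hL) hL,
    Nat.findGreatest_spec (P := fun w => w ^ k ≤ L) (hb W hL) hL, ?_⟩
  by_contra hcon
  rw [not_lt] at hcon
  have := Nat.le_findGreatest (P := fun w => w ^ k ≤ L) (hb _ hcon) hcon
  omega

theorem Finset.sum_sub_le_of_subset {ι : Type*} [DecidableEq ι] {S J : Finset ι} (hSJ : S ⊆ J)
    (f : ι → ℝ) {τ : ℝ} (hτ : 0 < τ) :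
    ∑ t ∈ S, f t ≤ (∑ t ∈ J, f t) / 2 + τ / 8 * J.card + (∑ t ∈ J, f t ^ 2) / (2 * τ) := by
  have hpt : ∀ x : ℝ, x ≤ x / 2 + τ / 8 + x ^ 2 / (2 * τ) ∧
      0 ≤ x / 2 + τ / 8 + x ^ 2 / (2 * τ) := by
    intro x
    constructor
    · have : x / 2 + τ / 8 + x ^ 2 / (2 * τ) - x = (x - τ / 2) ^ 2 / (2 * τ) := by
        field_simp; ring
      have h2 : 0 ≤ (x - τ / 2) ^ 2 / (2 * τ) := by positivity
      linarith
    · have : x / 2 + τ / 8 + x ^ 2 / (2 * τ) = (x + τ / 2) ^ 2 / (2 * τ) := by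
        field_simp; ring
      rw [this]; positivity
  have h1 : ∑ t ∈ J, (f t / 2 + τ / 8 + f t ^ 2 / (2 * τ)) =
      (∑ t ∈ J, f t) / 2 + τ / 8 * J.card + (∑ t ∈ J, f t ^ 2) / (2 * τ) := by
    rw [sum_add_distrib, sum_add_distrib, sum_const, nsmul_eq_mul, sum_div, sum_div]
    ring
  rw [← h1]
  exact (sum_le_sum fun t _ => (hpt (f t)).1).trans
    (sum_le_sum_of_subset_of_nonneg hSJ fun t _ _ => (hpt (f t)).2)

theorem density_le_of_moment_bounds {l η σ x₁ x₂ y z s R U : ℝ} (hl : 1 ≤ l) (hη0 : 0 ≤ η)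
    (hη : η ≤ l / 10000) (hσ1 : σ ≤ 1) (h₁ : |x₁ - R| ≤ η)
    (hR : |R - 10 * l| ≤ 11 * η) (hy : y ≤ 20 * l + 24 * η) (hU : U ≤ l * (55 * l + 165 * η))
    (h₂ : x₂ ≤ R ^ 2 + U + η * l) (hz : z ≤ η) (hs : σ * (40 * l - η) - (y - x₁) - z ≤ s)
    (hs' : s - 10 * l * σ ≤ (x₁ - 10 * l) / 2 + 15 * l / 8 +
      (x₂ - 20 * l * x₁ + 100 * l ^ 2) / (2 * (15 * l))) : σ ≤ 0.459 := by
  rw [abs_le] at h₁ hR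
  have hl0 : 0 < l := by linarith
  have hsq : (R - 10 * l) ^ 2 ≤ (11 * η) ^ 2 := by
    rw [sq_le_sq, abs_of_nonneg (by positivity : 0 ≤ 11 * η)]
    exact abs_le.2 hR
  have hηl : η ^ 2 ≤ η * l := by nlinarith
  have hvar : x₂ - 20 * l * x₁ + 100 * l ^ 2 ≤ l * (55 * l + 310 * η) := by
    have : l * (R - η) ≤ l * x₁ := by gcongr; linarith [h₁.1]
    nlinarith
  have hdiv : (x₂ - 20 * l * x₁ + 100 * l ^ 2) / (2 * (15 * l)) ≤ (55 * l + 310 * η) / 30 := by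
    rw [div_le_iff₀ (by positivity)]
    linarith
  have hση : σ * η ≤ η := mul_le_of_le_one_left hη0 hσ1
  have hfin : σ * (30 * l) ≤ 0.459 * (30 * l) := by
    linarith [h₁.1, h₁.2, hR.1, hR.2]
  exact le_of_mul_le_mul_right hfin (by positivity)

end

section
open Polynomial Finset

theorem Polynomial.mertensSqSum_pow_ten_le {h : ℤ[X]} {ε C : ℝ}
    (hM : ∀ n : ℕ, 1 ≤ n → |h.mertensSum n - Real.log n| ≤ ε * Real.log n + C) {w : ℕ}
    (hw : 1 ≤ w) : h.mertensSqSum (w ^ 10) ≤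
      Real.log w * (55 * Real.log w + (145 * (ε * Real.log w) + 20 * C)) := by
  have hpow : ∀ i : ℕ, |h.mertensSum (w ^ i) - i * Real.log w| ≤ ε * (i * Real.log w) + C := by
    intro i
    have := hM (w ^ i) (Nat.one_le_pow _ _ hw)
    rwa [Nat.cast_pow, Real.log_pow] at this
  refine (h.mertensSqSum_pow_le hw 10).trans ?_
  have hlog := Real.log_natCast_nonneg w
  refine mul_le_mul_of_nonneg_left ?_ hlog
  have h10 := (abs_le.1 (hpow 10)).2
  have hsum : ∑ i ∈ range 10, ((i : ℝ) * Real.log w - (ε * (i * Real.log w) + C)) ≤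
      ∑ i ∈ range 10, h.mertensSum (w ^ i) :=
    sum_le_sum fun i _ => by linarith [(abs_le.1 (hpow i)).1]
  simp only [sum_range_succ _ 9, sum_range_succ _ 8, sum_range_succ _ 7, sum_range_succ _ 6,
    sum_range_succ _ 5, sum_range_succ _ 4, sum_range_succ _ 3, sum_range_succ _ 2,
    sum_range_succ _ 1, sum_range_one] at hsum ⊢
  push_cast at hsum h10 ⊢
  linarith

theorem Polynomial.logPrimeSum_mono (h : ℤ[X]) {n m : ℕ} (hnm : n ≤ m) (t : ℕ) :
    h.logPrimeSum n t ≤ h.logPrimeSum m t :=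
  sum_le_sum_of_subset_of_nonneg (Nat.primesLE_mono hnm) fun p _ _ => by
    have := Real.log_natCast_nonneg p
    split_ifs <;> simp [this]

theorem Polynomial.logPrimePowSum_nonneg (h : ℤ[X]) (P H t : ℕ) : 0 ≤ h.logPrimePowSum P H t :=
  sum_nonneg fun p _ => sum_nonneg fun j _ => by
    have := Real.log_natCast_nonneg p
    split_ifs <;> simp [this]

theorem Polynomial.sum_logPrimeSum_ge {h : ℤ[X]} {S J : Finset ℕ} (hSJ : S ⊆ J) {y P H : ℕ}
    (hyP : y ≤ P) {b : ℝ}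
    (hb : ∀ t ∈ S, b ≤ h.logPrimeSum P t + h.logPrimePowSum P H t) :
    S.card * b - (∑ t ∈ J, h.logPrimeSum P t - ∑ t ∈ J, h.logPrimeSum y t) -
      ∑ t ∈ J, h.logPrimePowSum P H t ≤ ∑ t ∈ S, h.logPrimeSum y t := by
  have h1 : S.card * b ≤ ∑ t ∈ S, h.logPrimeSum y t +
      ∑ t ∈ S, (h.logPrimeSum P t - h.logPrimeSum y t) + ∑ t ∈ S, h.logPrimePowSum P H t := by
    rw [← nsmul_eq_mul, ← sum_const, ← sum_add_distrib, ← sum_add_distrib]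
    exact sum_le_sum fun t ht => by linarith [hb t ht]
  have h2 : ∑ t ∈ S, (h.logPrimeSum P t - h.logPrimeSum y t) ≤
      ∑ t ∈ J, (h.logPrimeSum P t - h.logPrimeSum y t) :=
    sum_le_sum_of_subset_of_nonneg hSJ fun t _ _ => sub_nonneg.2 (h.logPrimeSum_mono hyP t)
  have h3 : ∑ t ∈ S, h.logPrimePowSum P H t ≤ ∑ t ∈ J, h.logPrimePowSum P H t :=
    sum_le_sum_of_subset_of_nonneg hSJ fun t _ _ => h.logPrimePowSum_nonneg P H t
  rw [sum_sub_distrib, sum_sub_distrib] at h2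
  rw [sum_sub_distrib] at h1
  linarith

set_option maxHeartbeats 400000 in
theorem Polynomial.exists_forall_card_smooth_le {h : ℤ[X]} {c : ℝ}
    (hc : ∀ p j : ℕ, p.Prime → j ≠ 0 → (h.rootCountMod (p ^ j) : ℝ) ≤ c)
    (hM : ∀ ε : ℝ, 0 < ε → ∃ C : ℝ, 0 ≤ C ∧ ∀ n : ℕ, 1 ≤ n →
      |h.mertensSum n - Real.log n| ≤ ε * Real.log n + C)
    {B : ℝ} {e t₀ : ℕ} (hne : ∀ t : ℕ, t₀ ≤ t → h.eval (t : ℤ) ≠ 0)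
    (hlow : ∀ t : ℕ, t₀ ≤ t → 2 * Real.log t - B ≤ Real.log |((h.eval (t : ℤ) : ℤ) : ℝ)|)
    (hup : ∀ t : ℕ, t₀ ≤ t → |h.eval (t : ℤ)| ≤ (t : ℤ) ^ e) (κ : ℝ) :
    ∃ L₀ : ℕ, ∀ L T P : ℕ, L₀ ≤ L → L ≤ T → T + L ≤ P → (P : ℝ) ≤ κ * L →
      ∀ S ⊆ Ico T (T + L), (∀ t ∈ S, ∀ p : ℕ, p.Prime → (p : ℤ) ∣ h.eval (t : ℤ) → p ≤ P) →
        (S.card : ℝ) ≤ 0.459 * L := by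
  obtain ⟨C, hC0, hMC⟩ := hM (1 / 10000) (by norm_num)
  obtain ⟨Z, hZ0, hZ⟩ := exists_sum_logPrimePowSum_le hc
  have hc1 : ∀ p : ℕ, p.Prime → (h.rootCountMod p : ℝ) ≤ c := fun p hp => by
    simpa using hc p 1 hp one_ne_zero
  have hc0 : 0 ≤ c := (Nat.cast_nonneg _).trans (hc1 2 Nat.prime_two)
  obtain ⟨D, hD1, hDC, hDB, hDcκ, hDc2, hDZ, hDκ⟩ : ∃ D : ℝ, 1 ≤ D ∧ C ≤ D ∧ |B| ≤ D ∧
      2 * c * |κ| ≤ D ∧ 4 * c ^ 2 + 2 * c ≤ D ∧ Z * (1 + e * |κ|) ≤ D ∧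
      20 * Real.log 2 + |Real.log κ| ≤ D := by
    have h0 := Real.log_nonneg (show (1 : ℝ) ≤ 2 by norm_num)
    have h1 := abs_nonneg B
    have h2 : 0 ≤ 2 * c * |κ| := by positivity
    have h3 : 0 ≤ 4 * c ^ 2 := by positivity
    have h4 : 0 ≤ Z * (1 + e * |κ|) := by positivity
    have h5 := abs_nonneg (Real.log κ)
    refine ⟨1 + C + |B| + 2 * c * |κ| + 2 * c + (4 * c ^ 2 + 2 * c) + Z * (1 + e * |κ|) +
      (20 * Real.log 2 + |Real.log κ|), ?_, ?_, ?_, ?_, ?_, ?_, ?_⟩ <;> linarith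
  obtain ⟨W, hW1, hW⟩ : ∃ W : ℕ, 1 ≤ W ∧ Real.exp (10000 * D) ≤ W :=
    ⟨_, Nat.one_le_ceil_iff.2 (Real.exp_pos _), Nat.le_ceil _⟩
  refine ⟨max (W ^ 20) t₀, fun L T P hL hLT hTP hPκ S hSJ hSP => ?_⟩
  obtain ⟨hWL, htL⟩ := max_le_iff.1 hL
  obtain ⟨w, hWw, hwL, hLw⟩ := Nat.exists_le_pow_le_lt_succ_pow (k := 20) (by norm_num) hWL
  clear hL hWL
  have hw1 : 1 ≤ w := hW1.trans hWw
  have hw0 : (0 : ℝ) < w := by exact_mod_cast hw1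
  obtain ⟨l, hl⟩ : ∃ l, l = Real.log w := ⟨_, rfl⟩
  have hDl : 10000 * D ≤ l := by
    have h1 : Real.exp (10000 * D) ≤ w := hW.trans (by exact_mod_cast hWw)
    have := Real.log_le_log (Real.exp_pos _) h1
    rwa [Real.log_exp, ← hl] at this
  clear hW
  obtain ⟨η, hη⟩ : ∃ η, η = l / 10000 := ⟨_, rfl⟩
  have hDη : D ≤ η := by rw [hη]; linarith
  have hl1 : 1 ≤ l := by linarith
  have hη0 : 0 ≤ η := by linarith
  have hη1 : 1 ≤ η := by linarith
  have hlog2 := Real.log_nonneg (show (1 : ℝ) ≤ 2 by norm_num)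
  have hL1 : 1 ≤ L := (Nat.one_le_pow _ _ hw1).trans hwL
  have hL0 : (0 : ℝ) < L := by exact_mod_cast hL1
  have hP1 : (1 : ℝ) ≤ P := by
    have : 1 ≤ P := by omega
    exact_mod_cast this
  have hκ0 : 0 < κ := by
    by_contra hcon
    have : κ * L ≤ 0 := mul_nonpos_of_nonpos_of_nonneg (not_lt.1 hcon) hL0.le
    linarith
  have hκabs : |κ| = κ := abs_of_pos hκ0
  obtain ⟨y, hy⟩ : ∃ y, y = w ^ 10 := ⟨_, rfl⟩
  have hyyL : (y : ℝ) ^ 2 ≤ L := by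
    have : y ^ 2 ≤ L := hy ▸ (pow_mul w 10 2).symm.trans_le hwL
    exact_mod_cast this
  have hyL : y ≤ L := hy ▸ (Nat.pow_le_pow_right hw1 (by norm_num)).trans hwL
  have hyL' : (y : ℝ) ≤ L := by exact_mod_cast hyL
  have hlogL : 20 * l ≤ Real.log L := by
    have h1 : (w : ℝ) ^ 20 ≤ L := by exact_mod_cast hwL
    have := Real.log_le_log (pow_pos hw0 20) h1
    rw [Real.log_pow, ← hl] at this
    exact_mod_cast this
  have hlogL' : Real.log L ≤ 20 * (Real.log 2 + l) := by
    have h1 : (L : ℝ) ≤ (2 * w) ^ 20 := by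
      have : L ≤ (2 * w) ^ 20 := hLw.le.trans (Nat.pow_le_pow_left (by omega) _)
      exact_mod_cast this
    have := Real.log_le_log hL0 h1
    rw [Real.log_pow, Real.log_mul (by norm_num) hw0.ne', ← hl] at this
    exact_mod_cast this
  have hlogP : Real.log P ≤ 20 * l + η := by
    have := Real.log_le_log (by linarith) hPκ
    rw [Real.log_mul hκ0.ne' hL0.ne'] at this
    have h2 := le_abs_self (Real.log κ)
    linarith
  rw [hκabs] at hDcκ hDZ
  have hCη : C ≤ η := hDC.trans hDη
  have hBη : |B| ≤ η := hDB.trans hDη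
  have hcκη : 2 * c * κ ≤ η := hDcκ.trans hDη
  have hc2η : 4 * c ^ 2 + 2 * c ≤ η := hDc2.trans hDη
  have hZη : Z * (1 + e * κ) ≤ η := hDZ.trans hDη
  set J := Ico T (T + L) with hJ
  have hJcard : (J.card : ℝ) = L := by rw [hJ, Nat.card_Ico, Nat.add_sub_cancel_left]
  have hlogy : Real.log (y : ℝ) = 10 * l := by
    rw [hy, Nat.cast_pow, Real.log_pow, hl]; norm_num
  have hM1 := abs_sum_logPrimeSum_sub_le hc1 y T L
  have hM2 := sum_logPrimeSum_sq_le hc1 y T L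
  have hMP := abs_sum_logPrimeSum_sub_le hc1 P T L
  have hMZ := hZ P e T L
  have hRy := hMC y (hy ▸ Nat.one_le_pow _ _ hw1)
  have hRP := hMC P (by exact_mod_cast hP1)
  have hU := mertensSqSum_pow_ten_le hMC hw1
  rw [hlogy] at hRy
  rw [← hl, ← hy] at hU
  clear hwL hLw hy hWw
  rw [← hJ] at hM1 hM2 hMP hMZ
  have hSge := sum_logPrimeSum_ge (h := h) hSJ (y := y) (P := P) (H := P ^ e)
    (by omega) (b := 40 * l - η) (by
      intro t ht
      obtain ⟨hTt, htTL⟩ := mem_Ico.1 (hSJ ht)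
      have htt : t₀ ≤ t := htL.trans (hLT.trans hTt)
      refine le_trans ?_ (h.log_abs_eval_le (hne t htt) ?_ (hSP t ht))
      · refine le_trans ?_ (hlow t htt)
        have h1 : Real.log L ≤ Real.log t :=
          Real.log_le_log hL0 (by exact_mod_cast hLT.trans hTt)
        have := le_abs_self B
        linarith
      · refine (hup t htt).trans ?_
        have : t ^ e ≤ P ^ e := Nat.pow_le_pow_left (by omega) _
        exact_mod_cast this)
  have hAM := sum_sub_le_of_subset hSJ (fun t => h.logPrimeSum y t - 10 * l)
    (τ := 15 * l) (by linarith)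
  have hsq : ∑ t ∈ J, (h.logPrimeSum y t - 10 * l) ^ 2 =
      ∑ t ∈ J, h.logPrimeSum y t ^ 2 - 20 * l * ∑ t ∈ J, h.logPrimeSum y t +
        100 * l ^ 2 * L := by
    rw [← hJcard, mul_comm _ (J.card : ℝ), ← nsmul_eq_mul, ← sum_const, mul_sum,
      ← sum_sub_distrib, ← sum_add_distrib]
    exact sum_congr rfl fun t _ => by ring
  rw [hsq, sum_sub_distrib, sum_sub_distrib, sum_const, sum_const, nsmul_eq_mul, nsmul_eq_mul,
    hJcard] at hAM
  set X₁ := ∑ t ∈ J, h.logPrimeSum y t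
  set X₂ := ∑ t ∈ J, h.logPrimeSum y t ^ 2
  set Y := ∑ t ∈ J, h.logPrimeSum P t
  set V := ∑ t ∈ J, h.logPrimePowSum P (P ^ e) t
  set A := ∑ t ∈ S, h.logPrimeSum y t
  set R := h.mertensSum y
  set U := h.mertensSqSum y
  set s : ℝ := (S.card : ℝ)
  have hs : s = (s / L) * L := by field_simp
  have key : s / L ≤ 0.459 := by
    refine density_le_of_moment_bounds (l := l) (η := η) (x₁ := X₁ / L) (x₂ := X₂ / L)
      (y := Y / L) (z := V / L) (s := A / L) (R := R) (U := U) hl1 hη0 hη.le ?_ ?_ ?_ ?_ ?_ ?_ ?_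
      ?_ ?_
    · rw [div_le_one hL0, ← hJcard]
      exact Nat.cast_le.2 (card_le_card hSJ)
    · have h1 : X₁ / L - R = (X₁ - L * R) / L := by field_simp
      rw [h1, abs_div, abs_of_pos hL0, div_le_iff₀ hL0]
      refine hM1.trans ?_
      gcongr
      linarith [sq_nonneg c]
    · refine hRy.trans ?_
      linarith
    · rw [div_le_iff₀ hL0]
      have h1 := (abs_le.1 hMP).2
      have h2 := (abs_le.1 hRP).2
      have h3 : 2 * c * P ≤ η * L := by
        calc 2 * c * P ≤ 2 * c * (κ * L) := by gcongr
          _ = 2 * c * κ * L := by ring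
          _ ≤ η * L := by gcongr
      have h4 : h.mertensSum P ≤ 20 * l + 23 * η := by linarith
      have h5 : L * h.mertensSum P ≤ L * (20 * l + 23 * η) := by gcongr
      linarith
    · refine hU.trans ?_
      gcongr
      linarith
    · rw [div_le_iff₀ hL0]
      have h1 : (4 * c ^ 2 + 2 * c) * (y : ℝ) ^ 2 ≤ η * L := by gcongr
      have h2 : η * L ≤ η * l * L := by
        gcongr
        exact le_mul_of_one_le_right hη0 hl1
      linarith
    · rw [div_le_iff₀ hL0]
      calc V ≤ Z * (L + e * P) := hMZ
        _ ≤ Z * (L + e * (κ * L)) := by gcongr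
        _ = Z * (1 + e * κ) * L := by ring
        _ ≤ η * L := by gcongr
    · have h1 : s / L * (40 * l - η) - (Y / L - X₁ / L) - V / L =
          (s * (40 * l - η) - (Y - X₁) - V) / L := by field_simp
      rw [h1]
      gcongr
    · have h1 : A / L - 10 * l * (s / L) = (A - s * (10 * l)) / L := by field_simp
      have h2 : (X₁ / L - 10 * l) / 2 + 15 * l / 8 +
          (X₂ / L - 20 * l * (X₁ / L) + 100 * l ^ 2) / (2 * (15 * l)) =
          ((X₁ - L * (10 * l)) / 2 + 15 * l / 8 * L +
            (X₂ - 20 * l * X₁ + 100 * l ^ 2 * L) / (2 * (15 * l))) / L := by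
        field_simp
      rw [h1, h2]
      gcongr
  rw [hs]
  gcongr

end

section
open Polynomial Filter Asymptotics

theorem Polynomial.exists_mul_add_mul_derivative_eq_C {f : ℤ[X]}
    (hf : (f.map (algebraMap ℤ ℚ)).Separable) :
    ∃ (u v : ℤ[X]) (Δ : ℤ), Δ ≠ 0 ∧ u * f + v * derivative f = C Δ := by
  obtain ⟨a, b, hab⟩ := hf
  obtain ⟨s, hs0, hs⟩ := IsLocalization.integerNormalization_spec (nonZeroDivisors ℤ) a
  obtain ⟨t, ht0, ht⟩ := IsLocalization.integerNormalization_spec (nonZeroDivisors ℤ) b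
  refine ⟨C (t : ℤ) * IsLocalization.integerNormalization (nonZeroDivisors ℤ) a,
    C s * IsLocalization.integerNormalization (nonZeroDivisors ℤ) b, s * t,
    mul_ne_zero (nonZeroDivisors.ne_zero hs0) (nonZeroDivisors.ne_zero ht0), ?_⟩
  apply map_injective (algebraMap ℤ ℚ) Int.cast_injective
  simp only [Polynomial.map_add, Polynomial.map_mul, map_C, hs, ht, ← derivative_map]
  rw [zsmul_eq_mul, zsmul_eq_mul]
  have h1 : C ((algebraMap ℤ ℚ) (s * t)) =
      C ((algebraMap ℤ ℚ) s) * C ((algebraMap ℤ ℚ) t) := by simp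
  have h2 : ∀ z : ℤ, ((z : ℤ) : ℚ[X]) = C ((algebraMap ℤ ℚ) z) := fun z => by simp
  rw [h1, h2, h2]
  linear_combination (C ((algebraMap ℤ ℚ) s) * C ((algebraMap ℤ ℚ) t)) * hab

theorem Polynomial.exists_growth {h : ℤ[X]} (hd : 2 ≤ h.natDegree) :
    ∃ (B : ℝ) (e t₀ : ℕ), ∀ t : ℕ, t₀ ≤ t → h.eval (t : ℤ) ≠ 0 ∧
      2 * Real.log t - B ≤ Real.log |((h.eval (t : ℤ) : ℤ) : ℝ)| ∧
      |h.eval (t : ℤ)| ≤ (t : ℤ) ^ e := by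
  set f : ℝ[X] := h.map (Int.castRingHom ℝ) with hf
  have hev : ∀ t : ℕ, f.eval (t : ℝ) = ((h.eval (t : ℤ) : ℤ) : ℝ) := fun t => by
    rw [hf, ← Int.cast_natCast (R := ℝ) t, eval_intCast_map, eq_intCast, Int.cast_id]
  have hinj : Function.Injective (Int.castRingHom ℝ) := Int.cast_injective
  have h0 : h ≠ 0 := by rintro rfl; simp at hd
  have hdeg : f.degree = h.natDegree := by
    rw [hf, degree_map_eq_of_injective hinj, degree_eq_natDegree h0]
  have hlo : (fun x : ℝ => (X ^ 2 : ℝ[X]).eval x) =O[atTop] fun x => f.eval x := by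
    refine isBigO_atTop_of_degree_le _ _ ?_
    rw [degree_X_pow, hdeg]
    exact_mod_cast hd
  have hhi : (fun x : ℝ => f.eval x) =O[atTop] fun x => (X ^ h.natDegree : ℝ[X]).eval x := by
    refine isBigO_atTop_of_degree_le _ _ ?_
    rw [degree_X_pow, hdeg]
  obtain ⟨c, hc, hlo⟩ := hlo.exists_pos
  obtain ⟨c', hc', hhi⟩ := hhi.exists_pos
  have hev1 := (hlo.bound.and (hhi.bound.and ((eventually_ge_atTop c').and
    (eventually_ge_atTop 1))))
  obtain ⟨t₀, ht₀⟩ := eventually_atTop.1 (tendsto_natCast_atTop_atTop.eventually hev1)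
  refine ⟨Real.log c, h.natDegree + 1, t₀, fun t ht => ?_⟩
  obtain ⟨h1, h2, h3, h4⟩ := ht₀ t ht
  rw [hev] at h1 h2
  simp only [eval_pow, eval_X, Real.norm_eq_abs, abs_pow, Nat.abs_cast] at h1 h2
  have htpos : (0 : ℝ) < t := by linarith
  have hpos : 0 < |((h.eval (t : ℤ) : ℤ) : ℝ)| := by
    have h5 : 0 < (t : ℝ) ^ 2 := by positivity
    exact pos_of_mul_pos_right (h5.trans_le h1) hc.le
  refine ⟨?_, ?_, ?_⟩
  · intro h6
    simp [h6] at hpos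
  · have h5 := Real.log_le_log (by positivity) h1
    rw [Real.log_pow, Real.log_mul hc.ne' hpos.ne'] at h5
    push_cast at h5
    linarith
  · have h5 : |((h.eval (t : ℤ) : ℤ) : ℝ)| ≤ (t : ℝ) ^ (h.natDegree + 1) := by
      refine h2.trans ?_
      rw [pow_succ']
      gcongr
    exact_mod_cast h5

open NumberField in
theorem exists_forall_card_smooth_minpoly_le {K : Type*} [Field K] [NumberField K] {β : 𝓞 K}
    (hβ : Algebra.adjoin ℚ {(β : K)} = ⊤) (hd : 2 ≤ (minpoly ℤ β).natDegree) {A : ℕ} (hA : A ≠ 0)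
    (B : ℕ) (κ : ℝ) :
    ∃ L₀ : ℕ, ∀ L T P : ℕ, L₀ ≤ L → L ≤ T → T + L ≤ P → (P : ℝ) ≤ κ * L →
      ∀ S ⊆ Finset.Ico T (T + L), (∀ t ∈ S, ∀ p : ℕ, p.Prime →
        (p : ℤ) ∣ (minpoly ℤ β).eval ((A * t + B : ℕ) : ℤ) → p ≤ P) →
        (S.card : ℝ) ≤ 0.459 * L := by
  set g := minpoly ℤ β
  have hA' : (A : ℤ) ≠ 0 := by exact_mod_cast hA
  set ℓ : ℤ[X] := C (A : ℤ) * X + C (B : ℤ) with hℓ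
  have h_int : IsIntegral ℤ β := Algebra.IsIntegral.isIntegral β
  have hsep : (g.map (algebraMap ℤ ℚ)).Separable := by
    rw [← minpoly.isIntegrallyClosed_eq_field_fractions ℚ K h_int]
    exact (minpoly.irreducible (Algebra.IsIntegral.isIntegral _)).separable
  obtain ⟨u, v, Δ, hΔ0, hΔ⟩ := exists_mul_add_mul_derivative_eq_C hsep
  have hℓd : ℓ.natDegree = 1 := natDegree_linear hA'
  have hdeg : (g.comp ℓ).natDegree = g.natDegree := by rw [natDegree_comp, hℓd, mul_one]
  have h0 : g.comp ℓ ≠ 0 := by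
    intro h
    rw [h, natDegree_zero] at hdeg
    omega
  have hder : derivative (g.comp ℓ) = C (A : ℤ) * (derivative g).comp ℓ := by
    rw [derivative_comp, hℓ]; simp
  obtain ⟨c, -, hc⟩ := exists_rootCountMod_pow_le (u := C (A : ℤ) * u.comp ℓ) (v := v.comp ℓ)
    (Δ := A * Δ) h0 (mul_ne_zero hA' hΔ0) (by
      have := congrArg (fun f : ℤ[X] => f.comp ℓ) hΔ
      simp only [add_comp, mul_comp, C_comp] at this
      rw [hder, C_mul, ← this]
      ring)
  obtain ⟨B', e, t₀, hgrow⟩ := exists_growth (h := g.comp ℓ) (by omega)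
  obtain ⟨L₀, hL₀⟩ := exists_forall_card_smooth_le hc
    (fun ε hε => exists_sum_rootCountMod_asymp hβ hA B hε)
    (fun t ht => (hgrow t ht).1) (fun t ht => (hgrow t ht).2.1) (fun t ht => (hgrow t ht).2.2) κ
  refine ⟨L₀, fun L T P h1 h2 h3 h4 S hS hSP => hL₀ L T P h1 h2 h3 h4 S hS fun t ht p hp hpt =>
    hSP t ht p hp ?_⟩
  rw [eval_comp] at hpt
  simpa [hℓ] using hpt

end

theorem exists_forall_le_ncard_of_card_le {q b : ℕ} (hb : b < q) {bad : ℕ → ℕ → Prop}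
    (H : ∃ L₀ : ℕ, ∀ L T P : ℕ, L₀ ≤ L → L ≤ T → T + L ≤ P → (P : ℝ) ≤ (10 ^ 7 * q : ℕ) * L →
      ∀ S ⊆ Finset.Ico T (T + L), (∀ t ∈ S, bad (q * t + b) P) → (S.card : ℝ) ≤ 0.459 * L)
    (N₁ : ℕ) :
    ∃ N₀ : ℕ, 10 ^ 6 * q < N₀ ∧ N₁ ≤ N₀ ∧ ∀ N : ℕ, N₀ < N →
      ∀ M : ℕ, M = Nat.floor ((10 : ℝ) ^ (-6 : ℤ) * N) →
        (0.54 : ℝ) * M / q ≤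
          ({n : ℕ | N < n ∧ n ≤ N + M ∧ n % q = b ∧ ¬ bad n (N + M)}).ncard := by
  classical
  obtain ⟨L₀, H⟩ := H
  have hq : 0 < q := by omega
  refine ⟨10 ^ 6 * (q * (2000 + L₀)) + N₁, by nlinarith, by omega, fun N hN M hM => ?_⟩
  have hMdiv : M = N / 10 ^ 6 := by
    rw [hM, ← Nat.floor_div_eq_div (K := ℝ)]
    congr 1
    norm_num
    ring
  have hM1 : 10 ^ 6 * M ≤ N := by omega
  have hM2 : N < 10 ^ 6 * (M + 1) := by omega
  have hqM : q * (2000 + L₀) ≤ M := by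
    rw [hMdiv, Nat.le_div_iff_mul_le (by norm_num)]
    omega
  obtain ⟨L, hL⟩ : ∃ L, M / q = L + 1 := ⟨M / q - 1, by
    have : 2000 + L₀ ≤ M / q := by rwa [Nat.le_div_iff_mul_le hq, mul_comm]
    omega⟩
  have hL2 : 2000 + L₀ ≤ L + 1 := by
    rw [← hL, Nat.le_div_iff_mul_le hq, mul_comm]; exact hqM
  have hMq1 : q * (L + 1) ≤ M := by rw [← hL]; exact Nat.mul_div_le M q
  have hMq2 : M < q * (L + 2) := by
    have := Nat.lt_mul_div_succ M hq
    rwa [hL] at this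
  set T := N / q + 1 with hT
  have hT1 : N < q * T := Nat.lt_mul_div_succ N hq
  have hT2 : q * T ≤ N + q := by
    have := Nat.mul_div_le N q
    rw [hT, mul_add]; omega
  have hTL : q * (T + L) ≤ N + M := by nlinarith
  have hLT : L ≤ T := by
    have h1 : M ≤ N := by omega
    have h2 : M / q ≤ N / q := Nat.div_le_div_right h1
    omega
  have hTLP : T + L ≤ N + M := le_trans (Nat.le_mul_of_pos_left _ hq) hTL
  have hP : ((N + M : ℕ) : ℝ) ≤ (10 ^ 7 * q : ℕ) * L := by
    have : N + M ≤ 10 ^ 7 * q * L := by nlinarith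
    exact_mod_cast this
  set S := (Finset.Ico T (T + L)).filter (fun t => bad (q * t + b) (N + M)) with hS
  have hcard := H L T (N + M) (by omega) hLT hTLP hP S (Finset.filter_subset _ _)
    fun t ht => (Finset.mem_filter.1 ht).2
  set G := (Finset.Ico T (T + L)).filter (fun t => ¬ bad (q * t + b) (N + M)) with hG
  have hSG : S.card + G.card = L := by
    rw [hS, hG, Finset.card_filter_add_card_filter_not, Nat.card_Ico]
    omega
  have hfin : {n : ℕ | N < n ∧ n ≤ N + M ∧ n % q = b ∧ ¬ bad n (N + M)}.Finite :=
    (Set.finite_Iic (N + M)).subset fun n hn => hn.2.1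
  have hinj : Function.Injective (fun t => q * t + b) := fun s t hst => by
    simpa [hq.ne'] using hst
  have hGle : G.card ≤ {n : ℕ | N < n ∧ n ≤ N + M ∧ n % q = b ∧ ¬ bad n (N + M)}.ncard := by
    rw [← Finset.card_image_of_injective G hinj, ← Set.ncard_coe_finset]
    refine Set.ncard_le_ncard ?_ hfin
    intro n hn
    obtain ⟨t, ht, rfl⟩ := Finset.mem_image.1 (Finset.mem_coe.1 hn)
    obtain ⟨ht, htb⟩ := Finset.mem_filter.1 ht
    obtain ⟨ht1, ht2⟩ := Finset.mem_Ico.1 ht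
    refine ⟨?_, ?_, ?_, htb⟩
    · have := Nat.mul_le_mul_left q ht1
      show N < q * t + b
      omega
    · have := Nat.mul_le_mul_left q (Nat.succ_le_of_lt ht2)
      have h3 : q * t.succ = q * t + q := Nat.mul_succ q t
      show q * t + b ≤ N + M
      omega
    · show (q * t + b) % q = b
      rw [Nat.mul_add_mod, Nat.mod_eq_of_lt hb]
  have hGle' : (G.card : ℝ) ≤
      ({n : ℕ | N < n ∧ n ≤ N + M ∧ n % q = b ∧ ¬ bad n (N + M)}.ncard : ℝ) :=
    Nat.cast_le.2 hGle
  refine le_trans ?_ hGle'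
  have hq0 : (0 : ℝ) < q := by exact_mod_cast hq
  have h1 : (M : ℝ) / q ≤ L + 2 := by
    rw [div_le_iff₀ hq0, mul_comm]
    exact_mod_cast hMq2.le
  have h2 : (S.card : ℝ) + G.card = L := by exact_mod_cast hSG
  have h3 : (1999 : ℝ) ≤ L := by
    have : 1999 ≤ L := by omega
    exact_mod_cast this
  rw [mul_div_assoc]
  linarith

section
open NumberField Polynomial

theorem NumberField.exists_forall_le_ncard_primitive_divisor {K : Type*} [Field K] [NumberField K]
    {θ : K} (hθ : Algebra.adjoin ℚ {θ} = ⊤) (hθQ : θ ∉ (algebraMap ℚ K).range)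
    {q b : ℕ} (hb : b < q) {𝔞 : Ideal (𝓞 K)}
    (h𝔞 : ∀ r : 𝓞 K, r ∈ 𝔞 ↔ IsIntegral ℤ ((r : K) * θ)) {I : ℕ → Ideal (𝓞 K)}
    (hI : ∀ (n : ℕ) (y : 𝓞 K), y ∈ I n ↔ ∃ x ∈ 𝔞, (y : K) = ((n : K) + θ) * x) :
    ∃ N₀ : ℕ, 10 ^ 6 * q < N₀ ∧ ∀ N : ℕ, N₀ < N →
      ∀ M : ℕ, M = Nat.floor ((10 : ℝ) ^ (-6 : ℤ) * N) →
        (0.54 : ℝ) * M / q ≤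
          ({n : ℕ | N < n ∧ n ≤ N + M ∧ n % q = b ∧
            ∃ 𝔭 : Ideal (𝓞 K), 𝔭.IsPrime ∧ I n ≤ 𝔭 ∧
              ¬ (∏ m ∈ (Finset.range (N + M + 1)).erase n, I m) ≤ 𝔭}).ncard := by
  have hq : q ≠ 0 := by omega
  obtain ⟨a, ha, h_int⟩ : ∃ a : ℕ, a ≠ 0 ∧ IsIntegral ℤ ((a : K) * θ) := by
    obtain ⟨z, hz, hzθ⟩ := ((IsFractionRing.isAlgebraic_iff ℤ ℚ K (x := θ)).2
      (Algebra.IsAlgebraic.isAlgebraic θ)).exists_integral_multiple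
    refine ⟨z.natAbs, Int.natAbs_ne_zero.2 hz, ?_⟩
    rw [zsmul_eq_mul] at hzθ
    rcases Int.natAbs_eq z with h | h
    · rw [h] at hzθ
      simpa using hzθ
    · rw [h] at hzθ
      simpa using hzθ
  have haK : (a : K) ≠ 0 := Nat.cast_ne_zero.2 ha
  obtain ⟨β, hβ⟩ : ∃ β : 𝓞 K, (β : K) = -(a * θ) := ⟨⟨_, h_int.neg⟩, rfl⟩
  have hθβ : θ = (-(a : ℚ)⁻¹) • (β : K) := by
    rw [hβ, Algebra.smul_def]
    simp [haK]
  have hadj : Algebra.adjoin ℚ {(β : K)} = ⊤ := by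
    rw [eq_top_iff, ← hθ]
    refine Algebra.adjoin_le (Set.singleton_subset_iff.2 ?_)
    rw [hθβ]
    exact Subalgebra.smul_mem _ (Algebra.self_mem_adjoin_singleton ℚ (β : K)) _
  have hβint : IsIntegral ℤ β := Algebra.IsIntegral.isIntegral β
  have hdeg : 2 ≤ (minpoly ℤ β).natDegree := by
    have h1 : (minpoly ℚ (β : K)).natDegree = (minpoly ℤ β).natDegree := by
      rw [minpoly.isIntegrallyClosed_eq_field_fractions ℚ K hβint,
        (minpoly.monic hβint).natDegree_map]
    have h2 := minpoly.natDegree_pos hβint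
    have h3 : (minpoly ℚ (β : K)).natDegree ≠ 1 := by
      intro h
      obtain ⟨r, hr⟩ := minpoly.natDegree_eq_one_iff.1 h
      exact hθQ ⟨-(a : ℚ)⁻¹ * r, by rw [map_mul, hr, ← Algebra.smul_def, ← hθβ]⟩
    omega
  obtain ⟨D, hD0, hD⟩ := exists_intCast_mul_mem_adjoin hadj
  obtain ⟨L₀, hL₀⟩ := exists_forall_card_smooth_minpoly_le hadj hdeg (mul_ne_zero ha hq) (a * b)
    ((10 ^ 7 * q : ℕ) : ℝ)
  obtain ⟨N₀, hN₀q, hN₀, hcount⟩ := exists_forall_le_ncard_of_card_le hb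
    (bad := fun n P => ∀ p : ℕ, p.Prime → (p : ℤ) ∣ (minpoly ℤ β).eval ((a * n : ℕ) : ℤ) → p ≤ P)
    ⟨L₀, fun L T P h1 h2 h3 h4 S hS hSP => hL₀ L T P h1 h2 h3 h4 S hS fun t ht p hp hpt =>
      hSP t ht p hp (by rwa [mul_add, ← mul_assoc])⟩ (a + D.natAbs)
  refine ⟨N₀, hN₀q, fun N hN M hM => (hcount N hN M hM).trans (Nat.cast_le.2 ?_)⟩
  refine Set.ncard_le_ncard ?_ ((Set.finite_Iic (N + M)).subset fun n hn => hn.2.1)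
  rintro n ⟨hn1, hn2, hn3, hbad⟩
  refine ⟨hn1, hn2, hn3, ?_⟩
  push Not at hbad
  obtain ⟨p, hp, hpn, hpNM⟩ := hbad
  have hpD : ¬ (p : ℤ) ∣ D := fun h => by
    have := Int.natAbs_dvd_natAbs.2 h
    have := Nat.le_of_dvd (Int.natAbs_pos.2 hD0) this
    rw [Int.natAbs_natCast] at this
    omega
  have hpa : ¬ p ∣ a := fun h => by
    have := Nat.le_of_dvd (Nat.pos_of_ne_zero ha) h
    omega
  obtain ⟨𝔭, hmax, hp𝔭, hn𝔭⟩ := exists_isMaximal_of_dvd_eval_minpoly hβint hD hpD hpn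
  have hprime := hmax.isPrime
  have haco : algebraMap (𝓞 K) K (a : 𝓞 K) = a := map_natCast (algebraMap (𝓞 K) K) a
  have hcoe : ∀ m : ℕ, (((((a * m : ℕ) : ℤ) : 𝓞 K) - β : 𝓞 K) : K) = (m + θ) * a := fun m => by
    change algebraMap (𝓞 K) K _ = _
    rw [map_sub, ← RingOfIntegers.coe_eq_algebraMap β, hβ]
    simp
    ring
  have ha𝔭 : (a : 𝓞 K) ∉ 𝔭 := fun h =>
    hpa (Int.natCast_dvd_natCast.1 (natCast_dvd_of_intCast_mem hprime.ne_top hp hp𝔭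
      (m := a) (by simpa using h)))
  refine ⟨𝔭, hprime, fun y hy => ?_, fun hle => ?_⟩
  · obtain ⟨x, -, hx⟩ := (hI n y).1 hy
    have h1 : (a : 𝓞 K) * y = ((((a * n : ℕ) : ℤ) : 𝓞 K) - β) * x := by
      apply RingOfIntegers.ext
      change algebraMap (𝓞 K) K _ = algebraMap (𝓞 K) K _
      rw [map_mul, map_mul, map_natCast]
      linear_combination (a : K) * hx - (x : K) * hcoe n
    exact (hprime.mem_or_mem (h1 ▸ 𝔭.mul_mem_right x hn𝔭)).resolve_left ha𝔭
  · obtain ⟨m, hm, hm𝔭⟩ := hprime.prod_le.1 hle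
    obtain ⟨hmn, hm⟩ := Finset.mem_erase.1 hm
    have hm' := Finset.mem_range.1 hm
    have h1 : (((a * m : ℕ) : ℤ) : 𝓞 K) - β ∈ 𝔭 := by
      refine hm𝔭 ((hI m _).2 ⟨(a : 𝓞 K), (h𝔞 _).2 ?_, ?_⟩)
      · change IsIntegral ℤ (algebraMap (𝓞 K) K (a : 𝓞 K) * θ)
        rwa [haco]
      · exact (hcoe m).trans (by rw [← haco])
    have h2 : ((((a * n : ℕ) : ℤ) - ((a * m : ℕ) : ℤ) : ℤ) : 𝓞 K) ∈ 𝔭 := by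
      have := 𝔭.sub_mem hn𝔭 h1
      rwa [sub_sub_sub_cancel_right, ← Int.cast_sub] at this
    have h3 := natCast_dvd_of_intCast_mem hprime.ne_top hp hp𝔭 h2
    rw [Nat.cast_mul, Nat.cast_mul, ← mul_sub] at h3
    rcases (Nat.prime_iff_prime_int.1 hp).dvd_or_dvd h3 with h4 | h4
    · exact hpa (Int.natCast_dvd_natCast.1 h4)
    · have h5 := Int.eq_zero_of_abs_lt_dvd h4 (abs_lt.2 ⟨by omega, by omega⟩)
      omega

end

/-- Lemma 2 of the paper: Let `0 < α < 1` be algebraic irrational,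
`K = ℚ(α)` with ring of integers `O_K = integralClosure ℤ K`, `𝔞` the denominator ideal
of `α`, and `I n = (n+α)·𝔞` the corresponding integral ideals. For a positive integer `q`
and `b ∈ {0, …, q-1}` there is `N₀ > 10^6·q` such that for all `N > N₀`, with
`M = ⌊10^{-6}·N⌋`, at least `0.54·M/q` of the integers `n ≡ b (mod q)` with
`N < n ≤ N + M` admit a prime ideal `𝔭 ∣ I n` with `𝔭 ∤ ∏_{m ≤ N+M, m ≠ n} I m`
(divisibility of ideals being reverse containment). -/
theorem cassels_style_lemma
    (α : ℝ) (hα0 : 0 < α) (hα1 : α < 1)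
    (halg : IsAlgebraic ℚ α) (hirr : Irrational α)
    (q : ℕ) (hq : 0 < q) (b : ℕ) (hb : b < q)
    (αK : IntermediateField.adjoin ℚ ({α} : Set ℝ)) (hαK : (αK : ℝ) = α)
    (𝔞 : Ideal (integralClosure ℤ (IntermediateField.adjoin ℚ ({α} : Set ℝ))))
    (h𝔞 : ∀ r : integralClosure ℤ (IntermediateField.adjoin ℚ ({α} : Set ℝ)),
      r ∈ 𝔞 ↔ (r : IntermediateField.adjoin ℚ ({α} : Set ℝ)) * αK ∈
        integralClosure ℤ (IntermediateField.adjoin ℚ ({α} : Set ℝ)))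
    (I : ℕ → Ideal (integralClosure ℤ (IntermediateField.adjoin ℚ ({α} : Set ℝ))))
    (hI : ∀ (n : ℕ) (y : integralClosure ℤ (IntermediateField.adjoin ℚ ({α} : Set ℝ))),
      y ∈ I n ↔ ∃ x ∈ 𝔞,
        (y : IntermediateField.adjoin ℚ ({α} : Set ℝ)) =
          ((n : IntermediateField.adjoin ℚ ({α} : Set ℝ)) + αK) * x) :
    ∃ N₀ : ℕ, 10 ^ 6 * q < N₀ ∧ ∀ N : ℕ, N₀ < N →
      ∀ M : ℕ, M = Nat.floor ((10 : ℝ) ^ (-6 : ℤ) * N) →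
        (0.54 : ℝ) * M / q ≤
          ({n : ℕ | N < n ∧ n ≤ N + M ∧ n % q = b ∧
            ∃ 𝔭 : Ideal (integralClosure ℤ (IntermediateField.adjoin ℚ ({α} : Set ℝ))),
              𝔭.IsPrime ∧ I n ≤ 𝔭 ∧
                ¬ (∏ m ∈ (Finset.range (N + M + 1)).erase n, I m) ≤ 𝔭}).ncard := by
  have hfin : FiniteDimensional ℚ (IntermediateField.adjoin ℚ ({α} : Set ℝ)) :=
    IntermediateField.adjoin.finiteDimensional halg.isIntegral
  have : NumberField (IntermediateField.adjoin ℚ ({α} : Set ℝ)) := ⟨⟩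
  have hgen : αK = IntermediateField.AdjoinSimple.gen ℚ α := Subtype.ext hαK
  have htop : Algebra.adjoin ℚ {αK} = ⊤ := by
    rw [hgen]
    exact (IntermediateField.adjoin.powerBasis halg.isIntegral).adjoin_gen_eq_top
  have hQ : αK ∉ (algebraMap ℚ (IntermediateField.adjoin ℚ ({α} : Set ℝ))).range := by
    rintro ⟨r, hr⟩
    exact hirr ⟨r, by rw [← hαK, ← hr]; simp⟩
  exact NumberField.exists_forall_le_ncard_primitive_divisor htop hQ hb h𝔞 hI
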